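/- Let n ≥ 1 and let U ⊂ ℝ^{2n} be a bounded open neighborhood of the origin. Then there exists a finite constant C > 0, depending only on U, such that every smooth function H : ℝ^{2n} → ℝ whose support is a compact subset of U and which satisfies H(0) > C has a fast periodic orbit; that is, there exist T ∈ (0,1] and a nonconstant T-periodic solution γ of γ'(t) = J∇H(γ(t)). -/

import Mathlib

open scoped RealInnerProductSpace ENNReal NNReal Topology
open Metric Set

noncomputable section

/-- `ℝ^{2n}` identified with `ℂ^n`, with the standard (real) inner product and
the standard complex structure `J` given by multiplication by `i`. -/
abbrev Esp (n : ℕ) := EuclideanSpace ℂ (Fin n)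

variable {n : ℕ}

/-- The Hamiltonian vector field `X_H = J ∇H` of `H : ℝ^{2n} → ℝ`. -/
def hamVF (H : Esp n → ℝ) (x : Esp n) : Esp n := Complex.I • gradient H x

/-- A nonconstant `T`-periodic orbit of the Hamiltonian flow of `H`:
a nonconstant solution `γ` of `γ' = J∇H(γ)` with `γ (t + T) = γ t`. -/
def IsPeriodicOrbit (H : Esp n → ℝ) (γ : ℝ → Esp n) (T : ℝ) : Prop :=
  0 < T ∧ (∀ t, HasDerivAt γ (hamVF H (γ t)) t) ∧
    (∀ t, γ (t + T) = γ t) ∧ ∃ t₀ t₁, γ t₀ ≠ γ t₁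

/-- `H` has a fast (period `≤ 1`) nonconstant periodic orbit. -/
def HasFastOrbit (H : Esp n → ℝ) : Prop :=
  ∃ γ T, IsPeriodicOrbit H γ T ∧ T ≤ 1

/-- The symplectic action of a `1`-periodic loop `γ` with respect to the
(possibly time-dependent) Hamiltonian `H`:
`A_H(γ) = -(1/2)∫₀¹ ⟨Jγ(t), γ'(t)⟩ dt + ∫₀¹ H(t, γ(t)) dt`. -/
def action (H : ℝ → Esp n → ℝ) (γ : ℝ → Esp n) : ℝ :=
  -(1 / 2) * (∫ t in (0:ℝ)..1, ⟪(Complex.I • γ t : Esp n), deriv γ t⟫) +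
    ∫ t in (0:ℝ)..1, H t (γ t)

/-- The class `𝓗(V, Z)`: smooth functions on `ℝ^{2n}` with compact support
contained in `V`, constant on a neighborhood of `Z`, whose value on `Z` is the
maximum of `H`. -/
def InHclass (V Z : Set (Esp n)) (H : Esp n → ℝ) : Prop :=
  ContDiff ℝ (⊤ : ℕ∞) H ∧ IsCompact (tsupport H) ∧ tsupport H ⊆ V ∧
    (∃ U, IsOpen U ∧ Z ⊆ U ∧ ∃ c : ℝ, ∀ x ∈ U, H x = c) ∧
    ∀ z ∈ Z, ∀ x, H x ≤ H z

/-- The relative Hofer–Zehnder capacity `c_HZ(V, Z)`: the supremum of `max H`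
over all `H ∈ 𝓗(V, Z)` having no fast nonconstant periodic orbit (for `z ∈ Z`,
`H z = max H`). -/
def relCap (V Z : Set (Esp n)) : ℝ≥0∞ :=
  sSup {c | ∃ H, InHclass V Z H ∧ ¬ HasFastOrbit H ∧
    ∃ z ∈ Z, c = ENNReal.ofReal (H z)}

namespace HZ

/-! ### Part 1: a form of Brouwer's theorem -/

/-- Lagrange interpolation for `t ↦ det (1 + t M)`. -/
lemma det_interp {W : Type*} [NormedAddCommGroup W] [NormedSpace ℝ W] [FiniteDimensional ℝ W]
    (t0 : ℝ) (ht0 : 0 < t0) :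
    ∃ (m : ℕ) (t w : Fin m → ℝ), (∀ i, 0 < t i ∧ t i < t0) ∧ ∑ i, w i = 1 ∧
      ∀ M : W →L[ℝ] W, (1 + M).det = ∑ i, w i * (1 + t i • M).det := by
  set d := Module.finrank ℝ W
  let t : Fin (d+1) → ℝ := fun i => t0 * (i + 1) / (d + 2)
  have hinj : Function.Injective t := by
    intro i j hij
    have h1 : (d:ℝ) + 2 ≠ 0 := by positivity
    simp only [t] at hij
    field_simp at hij
    have : (i:ℝ) = j := by linarith
    exact Fin.ext (by exact_mod_cast this)
  refine ⟨d+1, t, fun i => (Lagrange.basis Finset.univ t i).eval 1, ?_, ?_, ?_⟩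
  · intro i
    refine ⟨by simp only [t]; positivity, ?_⟩
    simp only [t]
    rw [div_lt_iff₀ (by positivity)]
    have : (i:ℝ) < d + 1 := by exact_mod_cast i.2
    nlinarith
  · have := Lagrange.sum_basis (s := Finset.univ) (v := t) hinj.injOn ⟨0, Finset.mem_univ _⟩
    have h2 := congrArg (Polynomial.eval 1) this
    simpa [Polynomial.eval_finsetSum] using h2
  · intro M
    let b := Module.finBasis ℝ W
    let A := LinearMap.toMatrix b b (M : W →ₗ[ℝ] W)
    let p : Polynomial ℝ := ((Polynomial.X : Polynomial ℝ) • A.map Polynomial.C +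
      (1 : Matrix (Fin d) (Fin d) ℝ).map Polynomial.C).det
    have hp : ∀ s : ℝ, p.eval s = (1 + s • M).det := by
      intro s
      have h1 : (1 + s • M : W →L[ℝ] W).det = (s • A + 1).det := by
        rw [ContinuousLinearMap.det, ← LinearMap.det_toMatrix b]
        congr 1
        have : ((1 + s • M : W →L[ℝ] W) : W →ₗ[ℝ] W) = LinearMap.id + s • (M : W →ₗ[ℝ] W) := by
          ext; simp
        rw [this, map_add, map_smul, LinearMap.toMatrix_id, add_comm]
      rw [h1]
      simp only [p]
      rw [← Polynomial.coe_evalRingHom, RingHom.map_det]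
      congr 1
      ext i j
      by_cases hij : i = j
      · subst hij; simp; ring
      · simp [Matrix.one_apply_ne hij]; ring
    have hdeg : p.degree < (Finset.univ : Finset (Fin (d+1))).card := by
      have h := Polynomial.natDegree_det_X_add_C_le A (1 : Matrix (Fin d) (Fin d) ℝ)
      rw [Fintype.card_fin] at h
      refine lt_of_le_of_lt Polynomial.degree_le_natDegree ?_
      rw [Finset.card_univ, Fintype.card_fin]
      have : p.natDegree < d + 1 := Nat.lt_succ_of_le h
      exact_mod_cast this
    have h := Lagrange.eq_interpolate (s := Finset.univ) (v := t) hinj.injOn hdeg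
    have h2 := congrArg (Polynomial.eval 1) h
    rw [hp 1, one_smul, Lagrange.interpolate_apply, Polynomial.eval_finsetSum] at h2
    rw [h2]
    refine Finset.sum_congr rfl fun i _ => ?_
    rw [Polynomial.eval_mul, Polynomial.eval_C, hp, mul_comm]

/-- There is no `C¹` map to the sphere that is the identity on the sphere. -/
lemma no_retraction {W : Type*} [NormedAddCommGroup W] [InnerProductSpace ℝ W]
    [FiniteDimensional ℝ W] (r : W → W) (R : ℝ) (hR : 0 < R) (hr : ContDiff ℝ 1 r)
    (hnorm : ∀ x, ‖r x‖ = R) (hid : ∀ x, ‖x‖ = R → r x = x) : False := by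
  borelize W
  let μ : MeasureTheory.Measure W := MeasureTheory.Measure.addHaar
  have hdr : ∀ x, HasFDerivAt r (fderiv ℝ r x) x := fun x =>
    (hr.differentiable (by norm_num)).differentiableAt.hasFDerivAt
  have hcdr : Continuous (fderiv ℝ r) := hr.continuous_fderiv (by norm_num)
  let M : W → (W →L[ℝ] W) := fun x => fderiv ℝ r x - 1
  have hcM : Continuous M := hcdr.sub continuous_const
  -- the Lipschitz constant
  obtain ⟨L, hL0, hL⟩ : ∃ L : ℝ, 0 < L ∧ ∀ x ∈ closedBall (0:W) R, ‖M x‖ ≤ L := by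
    obtain ⟨L, hL⟩ := (isCompact_closedBall (0:W) R).exists_bound_of_continuousOn hcM.continuousOn
    exact ⟨max L 1, by positivity, fun x hx => (hL x hx).trans (le_max_left _ _)⟩
  let u : W → W := fun x => if ‖x‖ ≤ R then r x - x else 0
  have hu_in : ∀ x, ‖x‖ ≤ R → u x = r x - x := fun x hx => by simp [u, hx]
  have hu_out : ∀ x, R ≤ ‖x‖ → u x = 0 := fun x hx => by
    rcases hx.eq_or_lt with h | h
    · rw [hu_in x h.symm.le, hid x h.symm, sub_self]
    · simp [u, not_le.mpr h]
  have hlip_in : ∀ x y, ‖x‖ ≤ R → ‖y‖ ≤ R → ‖u x - u y‖ ≤ L * ‖x - y‖ := by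
    intro x y hx hy
    rw [hu_in x hx, hu_in y hy]
    have := (convex_closedBall (0:W) R).norm_image_sub_le_of_norm_hasFDerivWithin_le
      (f := fun x => r x - x) (f' := M) (C := L)
      (fun z _ => ((hdr z).sub (hasFDerivAt_id z)).hasFDerivWithinAt) hL
      (mem_closedBall_zero_iff.mpr hy) (mem_closedBall_zero_iff.mpr hx)
    exact this
  have hlip_mix : ∀ x y, ‖x‖ ≤ R → R ≤ ‖y‖ → ‖u x - u y‖ ≤ L * ‖x - y‖ := by
    intro x y hx hy
    have hcont : ContinuousOn (fun s : ℝ => ‖x + s • (y - x)‖) (Icc 0 1) := by fun_prop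
    obtain ⟨s, hs, hs2⟩ := intermediate_value_Icc (by norm_num : (0:ℝ) ≤ 1) hcont
      (show R ∈ Icc _ _ by simpa using ⟨hx, hy⟩)
    simp only at hs2
    set z := x + s • (y - x) with hz
    rw [hu_out y hy, ← hu_out z hs2.ge]
    refine (hlip_in x z hx hs2.le).trans ?_
    gcongr
    have : x - z = s • (x - y) := by rw [hz]; module
    rw [this, norm_smul, Real.norm_of_nonneg hs.1]
    nlinarith [norm_nonneg (x - y), hs.2]
  have hlip : ∀ x y, ‖u x - u y‖ ≤ L * ‖x - y‖ := by
    intro x y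
    rcases le_total ‖x‖ R with hx | hx <;> rcases le_total ‖y‖ R with hy | hy
    · exact hlip_in x y hx hy
    · exact hlip_mix x y hx hy
    · rw [norm_sub_rev, norm_sub_rev x]; exact hlip_mix y x hy hx
    · rw [hu_out x hx, hu_out y hy]; simp; positivity
  -- det positive near 1
  obtain ⟨ε, hε, hdet⟩ : ∃ ε > 0, ∀ A : W →L[ℝ] W, ‖A‖ < ε → 0 < (1 + A).det := by
    have hc : Continuous fun A : W →L[ℝ] W => (1 + A).det :=
      ContinuousLinearMap.continuous_det.comp (continuous_const.add continuous_id)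
    have : ∀ᶠ A in 𝓝 (0 : W →L[ℝ] W), 0 < (1 + A).det := by
      apply hc.continuousAt.eventually_const_lt
      simp [ContinuousLinearMap.det]
    obtain ⟨ε, hε, h⟩ := Metric.eventually_nhds_iff.mp this
    exact ⟨ε, hε, fun A hA => h (by simpa using hA)⟩
  set B := ball (0:W) R
  have hBvol : μ B ≠ ∞ := MeasureTheory.measure_ball_lt_top.ne
  have hBpos : 0 < μ B := Metric.measure_ball_pos μ 0 hR
  have hdetcont : ∀ s : ℝ, Continuous fun x => (1 + s • M x).det := fun s =>
    ContinuousLinearMap.continuous_det.comp (continuous_const.add (hcM.const_smul s))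
  have hintg : ∀ s : ℝ, MeasureTheory.IntegrableOn (fun x => (1 + s • M x).det) B μ := fun s =>
    ((hdetcont s).continuousOn.integrableOn_compact (isCompact_closedBall (0:W) R)).mono_set
      ball_subset_closedBall
  have key : ∀ s : ℝ, 0 < s → s < min (1 / L) (ε / L) →
      ∫ x in B, (1 + s • M x).det ∂μ = (μ B).toReal := by
    intro s hs0 hs
    have hs1 : s * L < 1 := by
      have := hs.trans_le (min_le_left _ _); rwa [lt_div_iff₀ hL0] at this
    have hs2 : s * L < ε := by
      have := hs.trans_le (min_le_right _ _); rwa [lt_div_iff₀ hL0] at this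
    let f : W → W := fun x => x + s • u x
    have hfinj : Function.Injective f := by
      intro x y hxy
      have h1 : x - y = s • (u y - u x) := by
        have : x + s • u x = y + s • u y := hxy
        rw [smul_sub, sub_eq_sub_iff_add_eq_add, this, add_comm]
      have h2 : ‖x - y‖ ≤ s * L * ‖x - y‖ := by
        calc ‖x - y‖ = s * ‖u y - u x‖ := by rw [h1, norm_smul, Real.norm_of_nonneg hs0.le]
          _ ≤ s * (L * ‖y - x‖) := by gcongr; exact hlip _ _
          _ = _ := by rw [norm_sub_rev]; ring
      have : ‖x - y‖ ≤ 0 := by nlinarith [norm_nonneg (x-y)]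
      exact sub_eq_zero.mp (norm_le_zero_iff.mp this)
    have hfsurj : Function.Surjective f := by
      intro y
      have hc : ContractingWith (Real.toNNReal (s * L)) (fun x => y - s • u x) := by
        refine ⟨?_, LipschitzWith.of_dist_le_mul fun a b => ?_⟩
        · rw [← NNReal.coe_lt_coe, Real.coe_toNNReal _ (by positivity)]; simpa using hs1
        · rw [Real.coe_toNNReal _ (by positivity), dist_eq_norm, dist_eq_norm]
          have : y - s • u a - (y - s • u b) = s • (u b - u a) := by module
          rw [this, norm_smul, Real.norm_of_nonneg hs0.le, mul_assoc, norm_sub_rev a]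
          gcongr; exact hlip _ _
      refine ⟨ContractingWith.fixedPoint _ hc, ?_⟩
      have := hc.fixedPoint_isFixedPt
      have h2 : y - s • u (ContractingWith.fixedPoint _ hc) = ContractingWith.fixedPoint _ hc := this
      simp only [f]
      nth_rw 1 [← h2]; abel
    have himg : f '' B = B := by
      have hout : ∀ x, R ≤ ‖x‖ → f x = x := fun x hx => by simp [f, hu_out x hx]
      apply Subset.antisymm
      · rintro _ ⟨x, hx, rfl⟩
        rw [mem_ball_zero_iff] at hx ⊢
        by_contra h
        push Not at h
        have h3 := hfinj (hout _ h)
        rw [h3] at h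
        linarith
      · intro y hy
        obtain ⟨x, rfl⟩ := hfsurj y
        refine ⟨x, ?_, rfl⟩
        rw [mem_ball_zero_iff] at hy ⊢
        by_contra h
        push Not at h
        rw [hout x h] at hy
        linarith
    have hder : ∀ x ∈ B, HasFDerivWithinAt f (1 + s • M x) B x := by
      intro x hx
      have h1 : HasFDerivWithinAt (fun x => x + s • (r x - x)) (1 + s • M x) B x := by
        have := (hasFDerivAt_id (𝕜 := ℝ) x).add (((hdr x).sub (hasFDerivAt_id x)).const_smul s)
        exact this.hasFDerivWithinAt
      refine h1.congr (fun y hy => ?_) ?_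
      · simp only [f]; rw [hu_in y (mem_ball_zero_iff.mp hy).le]
      · simp only [f]; rw [hu_in x (mem_ball_zero_iff.mp hx).le]
    have hch := MeasureTheory.lintegral_abs_det_fderiv_eq_addHaar_image μ measurableSet_ball hder
      hfinj.injOn
    rw [himg] at hch
    have hpos : ∀ x ∈ B, 0 < (1 + s • M x).det := by
      intro x hx
      apply hdet
      rw [norm_smul, Real.norm_of_nonneg hs0.le]
      exact lt_of_le_of_lt (by gcongr; exact hL x (ball_subset_closedBall hx)) hs2
    rw [← hch, MeasureTheory.integral_eq_lintegral_of_nonneg_ae]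
    · congr 1
      refine MeasureTheory.setLIntegral_congr_fun measurableSet_ball fun x hx => ?_
      rw [abs_of_pos (hpos x hx)]
    · filter_upwards [MeasureTheory.ae_restrict_mem measurableSet_ball] with x hx
      exact (hpos x hx).le
    · exact (hintg s).aestronglyMeasurable
  obtain ⟨m, t, w, ht, hw, hM⟩ := det_interp (W := W) (min (1 / L) (ε / L)) (by positivity)
  have h1 : ∫ x in B, (1 + M x).det ∂μ = (μ B).toReal := by
    have : (fun x => (1 + M x).det) = fun x => ∑ i, w i * (1 + t i • M x).det := by
      ext x; exact hM (M x)
    rw [this, MeasureTheory.integral_finsetSum _ (fun i _ => (hintg (t i)).const_mul (w i))]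
    simp_rw [MeasureTheory.integral_const_mul]
    rw [Finset.sum_congr rfl fun i _ => by rw [key (t i) (ht i).1 (ht i).2], ← Finset.sum_mul, hw,
      one_mul]
  have h2 : ∀ x, (1 + M x).det = 0 := by
    intro x
    have hMx : 1 + M x = fderiv ℝ r x := by simp [M]
    rw [hMx]
    by_contra hne
    have hsurj : Function.Surjective (fderiv ℝ r x) := by
      have hu : IsUnit (LinearMap.det (fderiv ℝ r x : W →ₗ[ℝ] W)) := isUnit_iff_ne_zero.mpr hne
      have := (LinearMap.isUnit_iff_isUnit_det _).mpr hu
      exact ((Module.End.isUnit_iff _).mp this).2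
    obtain ⟨v, hv⟩ := hsurj (r x)
    have hd : HasFDerivAt (fun x => ⟪r x, r x⟫) _ x := (hdr x).inner ℝ (hdr x)
    have hc : (fun x => ⟪r x, r x⟫) = fun _ => R ^ 2 := by
      ext y; rw [real_inner_self_eq_norm_sq, hnorm]
    rw [hc] at hd
    have h3 := hd.unique (hasFDerivAt_const (R^2) x)
    have h4 := congrArg (fun A => A v) h3
    simp [hv, hnorm] at h4
    exact hR.ne' (by simpa using h4)
  simp_rw [h2] at h1
  simp only [MeasureTheory.integral_zero] at h1
  exact (ENNReal.toReal_pos hBpos.ne' hBvol).ne h1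

lemma no_miss_zero {W : Type*} [NormedAddCommGroup W] [InnerProductSpace ℝ W]
    [FiniteDimensional ℝ W] (g : W → W) (hg : Continuous g) (τ : ℝ)
    (hid : ∀ y, τ ≤ ‖y‖ → g y = y) (hne : ∀ y, g y ≠ 0) : False := by
  obtain ⟨f, hf, happ, heq, -⟩ := hg.exists_contDiff_approx_and_eqOn (ε := fun x => ‖g x‖) 1
    hg.norm (fun x => norm_pos_iff.mpr (hne x)) (S := {x | |τ| + 1 ≤ ‖x‖}) (U := {x | τ < ‖x‖})
    (isClosed_le continuous_const continuous_norm)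
    ((isOpen_lt continuous_const continuous_norm).mem_nhdsSet.mpr
      (fun x hx => by
        have : |τ| + 1 ≤ ‖x‖ := hx
        have := le_abs_self τ
        show τ < ‖x‖
        linarith))
    (contDiffOn_id.congr fun x hx => hid x (le_of_lt hx))
  have hf0 : ∀ x, f x ≠ 0 := by
    intro x h0
    have := happ x
    simp [h0] at this
  have hR : 0 < |τ| + 1 := by positivity
  refine no_retraction (fun x => ((|τ| + 1) / ‖f x‖) • f x) (|τ| + 1) hR ?_ ?_ ?_
  · exact (contDiff_const.div (hf.norm ℝ hf0) (fun x => norm_ne_zero_iff.mpr (hf0 x))).smul hf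
  · intro x
    rw [norm_smul, norm_div, norm_norm, Real.norm_of_nonneg hR.le,
      div_mul_cancel₀ _ (norm_ne_zero_iff.mpr (hf0 x))]
  · intro x hx
    have h1 : f x = x := by
      rw [heq (show |τ| + 1 ≤ ‖x‖ from hx.ge)]
      exact hid x (by rw [hx]; linarith [le_abs_self τ])
    rw [h1, hx, div_self hR.ne', one_smul]

/-- A continuous self-map of a finite dimensional space, equal to the identity outside a
ball, is surjective. -/
lemma surj_of_id_outside {F : Type*} [NormedAddCommGroup F] [NormedSpace ℝ F]
    [FiniteDimensional ℝ F] (g : F → F) (hg : Continuous g) (τ : ℝ)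
    (hid : ∀ y, τ ≤ ‖y‖ → g y = y) : Function.Surjective g := by
  intro y0
  by_contra hmiss
  push Not at hmiss
  let W := EuclideanSpace ℝ (Fin (Module.finrank ℝ F))
  let e : W ≃L[ℝ] F := ContinuousLinearEquiv.ofFinrankEq (by simp [W])
  obtain ⟨c, hc0, hc⟩ : ∃ c : ℝ, 0 < c ∧ ∀ y, ‖y‖ ≤ c * ‖e y‖ := by
    refine ⟨‖(e.symm : F →L[ℝ] W)‖ + 1, by positivity, fun y => ?_⟩
    have := (e.symm : F →L[ℝ] W).le_opNorm (e y)
    simp at this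
    nlinarith [norm_nonneg (e y)]
  refine no_miss_zero (fun w => e.symm (g (e w + y0) - y0)) (by fun_prop) (c * (|τ| + ‖y0‖)) ?_ ?_
  · intro w hw
    have h1 : |τ| + ‖y0‖ ≤ ‖e w‖ := le_of_mul_le_mul_left (hw.trans (hc w)) hc0
    have h2 : τ ≤ ‖e w + y0‖ := by
      have := norm_sub_le (e w + y0) y0
      simp at this
      linarith [le_abs_self τ]
    rw [hid _ h2]; simp
  · intro w h
    have : g (e w + y0) - y0 = 0 :=
      (map_eq_zero_iff e.symm e.symm.injective).mp h
    exact hmiss _ (sub_eq_zero.mp this)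

end HZ

namespace HZ

/-! ### Part 2: an abstract finite dimensional minimax principle -/

lemma minimax {E F : Type*} [NormedAddCommGroup E] [InnerProductSpace ℝ E] [FiniteDimensional ℝ E]
    [NormedAddCommGroup F] [NormedSpace ℝ F] [FiniteDimensional ℝ F]
    (Φ : E → ℝ) (V : E → E) (hΦ : Continuous Φ) (hV : Continuous V) (Λ : ℝ) (hΛ : 0 < Λ)
    (hdesc : ∀ c d, Φ (c + d) ≤ Φ c + ⟪V c, d⟫ + Λ * ‖d‖ ^ 2)
    (a : ℝ) (ha : 0 < a) (M : ℝ) (hPS : ∀ c, a * ‖c‖ - M ≤ ‖V c‖)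
    (β : ℝ) (hβ : 0 < β) (j : F → E) (q : E → F) (hj : Continuous j) (hq : Continuous q)
    (y0 : F) (hy0 : q (j y0) = y0) (τ : ℝ) (h1 : ∀ y, τ ≤ ‖y‖ → Φ (j y) ≤ 0)
    (h2 : ∀ y, 0 < Φ (j y) → q (j y) = y) (h3 : ∀ c, q c = y0 → β ≤ Φ c) :
    ∃ c, V c = 0 ∧ β ≤ Φ c := by
  by_contra hcon
  push Not at hcon
  have hne : ∀ c, β ≤ Φ c → V c ≠ 0 := fun c hc h0 => absurd (hcon c h0) (not_lt.mpr hc)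
  -- lower bound for the gradient
  obtain ⟨κ, hκ0, hκ⟩ : ∃ κ : ℝ, 0 < κ ∧ ∀ c, β ≤ Φ c → κ ≤ ‖V c‖ := by
    let S := {c | β ≤ Φ c} ∩ closedBall (0:E) ((M + 1) / a)
    have hS : IsCompact S :=
      (isCompact_closedBall (0:E) _).inter_left (isClosed_le continuous_const hΦ)
    have hbig : ∀ c, c ∉ closedBall (0:E) ((M + 1) / a) → 1 ≤ ‖V c‖ := by
      intro c hc
      rw [mem_closedBall_zero_iff, not_le, div_lt_iff₀ ha] at hc
      linarith [hPS c]
    rcases S.eq_empty_or_nonempty with hemp | hnon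
    · refine ⟨1, one_pos, fun c hc => hbig c fun hc2 => ?_⟩
      have : c ∈ S := ⟨hc, hc2⟩
      rw [hemp] at this
      exact this
    · obtain ⟨c0, hc0, hmin⟩ := hS.exists_isMinOn hnon hV.norm.continuousOn
      refine ⟨min 1 ‖V c0‖, lt_min one_pos (norm_pos_iff.mpr (hne c0 hc0.1)), fun c hc => ?_⟩
      by_cases hc2 : c ∈ closedBall (0:E) ((M + 1) / a)
      · exact (min_le_right _ _).trans (hmin ⟨hc, hc2⟩)
      · exact (min_le_left _ _).trans (hbig c hc2)
  let h : ℝ := 1 / (2 * Λ)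
  have hh : 0 < h := by positivity
  have hhΛ : Λ * h ^ 2 = h / 2 := by simp only [h]; field_simp
  let χ : E → ℝ := fun c => max 0 (min 1 (Φ c / β))
  have hχ : Continuous χ := by fun_prop
  have hχ0 : ∀ c, 0 ≤ χ c := fun c => le_max_left _ _
  have hχ1 : ∀ c, χ c ≤ 1 := fun c => max_le zero_le_one (min_le_left _ _)
  let T : E → E := fun c => c + (-(h * χ c)) • V c
  have hT : Continuous T := by fun_prop
  have hTdec : ∀ c, Φ (T c) ≤ Φ c - h / 2 * χ c * ‖V c‖ ^ 2 := by
    intro c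
    have := hdesc c ((-(h * χ c)) • V c)
    rw [inner_smul_right, real_inner_self_eq_norm_sq, norm_smul, mul_pow, norm_neg,
      Real.norm_of_nonneg (mul_nonneg hh.le (hχ0 c)), mul_pow] at this
    have h5 : Λ * (h ^ 2 * χ c ^ 2 * ‖V c‖ ^ 2) = h / 2 * (χ c ^ 2 * ‖V c‖ ^ 2) := by
      rw [← hhΛ]; ring
    have h6 : χ c ^ 2 * ‖V c‖ ^ 2 ≤ χ c * ‖V c‖ ^ 2 := by
      gcongr; nlinarith [hχ0 c, hχ1 c]
    have h7 : h / 2 * (χ c ^ 2 * ‖V c‖ ^ 2) ≤ h / 2 * (χ c * ‖V c‖ ^ 2) := by gcongr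
    simp only [T]
    nlinarith
  have hTid : ∀ c, Φ c ≤ 0 → T c = c := by
    intro c hc
    have : χ c = 0 := by
      simp only [χ]
      refine max_eq_left ((min_le_right _ _).trans (div_nonpos_of_nonpos_of_nonneg hc hβ.le))
    simp [T, this]
  have hχβ : ∀ c, β ≤ Φ c → χ c = 1 := by
    intro c hc
    have : 1 ≤ Φ c / β := by rwa [le_div_iff₀ hβ, one_mul]
    simp [χ, min_eq_left this]
  have hTle : ∀ c, Φ (T c) ≤ Φ c := fun c => (hTdec c).trans (by
    have : 0 ≤ h / 2 * χ c * ‖V c‖ ^ 2 := by have := hχ0 c; positivity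
    linarith)
  have hiter : ∀ (m : ℕ) c, Φ (T^[m] c) < β ∨ Φ (T^[m] c) ≤ Φ c - m * (h / 2 * κ ^ 2) := by
    intro m c
    induction m with
    | zero => right; simp
    | succ m ih =>
      rw [Function.iterate_succ_apply']
      rcases ih with ih | ih
      · left; exact (hTle _).trans_lt ih
      · by_cases hlt : Φ (T^[m] c) < β
        · left; exact (hTle _).trans_lt hlt
        · right
          push Not at hlt
          have h5 := hTdec (T^[m] c)
          rw [hχβ _ hlt, mul_one] at h5
          have h6 := hκ _ hlt
          have h7 : h / 2 * κ ^ 2 ≤ h / 2 * ‖V (T^[m] c)‖ ^ 2 := by gcongr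
          push_cast
          linarith
  have hiterid : ∀ (m : ℕ) c, Φ c ≤ 0 → T^[m] c = c := fun m c hc =>
    Function.iterate_fixed (hTid c hc) m
  obtain ⟨B, hB⟩ : ∃ B : ℝ, ∀ y, Φ (j y) ≤ B := by
    obtain ⟨B, hB⟩ := (isCompact_closedBall (0:F) τ).exists_bound_of_continuousOn
      (hΦ.comp hj).continuousOn
    refine ⟨max B 0, fun y => ?_⟩
    by_cases hy : ‖y‖ ≤ τ
    · exact (le_abs_self _).trans ((hB y (mem_closedBall_zero_iff.mpr hy)).trans (le_max_left _ _))
    · exact (h1 y (not_le.mp hy).le).trans (le_max_right _ _)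
  obtain ⟨m, hm⟩ := exists_nat_gt (B / (h / 2 * κ ^ 2))
  have hm' : B < m * (h / 2 * κ ^ 2) := by rwa [div_lt_iff₀ (by positivity)] at hm
  have hlow : ∀ y, Φ (T^[m] (j y)) < β := by
    intro y
    rcases hiter m (j y) with h5 | h5
    · exact h5
    · linarith [hB y]
  let g : F → F := fun y => y + (q (T^[m] (j y)) - q (j y))
  have hg : Continuous g :=
    continuous_id.add ((hq.comp ((hT.iterate m).comp hj)).sub (hq.comp hj))
  have hgid : ∀ y, Φ (j y) ≤ 0 → g y = y := fun y hy => by simp [g, hiterid m _ hy]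
  obtain ⟨y, hy⟩ := surj_of_id_outside g hg τ (fun y hy => hgid y (h1 y hy)) y0
  by_cases hpos : 0 < Φ (j y)
  · have h5 : g y = q (T^[m] (j y)) := by
      simp only [g]; rw [h2 y hpos]; abel
    rw [h5] at hy
    exact absurd (h3 _ hy) (not_le.mpr (hlow y))
  · push Not at hpos
    rw [hgid y hpos] at hy
    subst hy
    linarith [h3 _ hy0]

end HZ

namespace HZ

/-! ### Part 3: Fourier polynomials and the Galerkin approximation -/

lemma inner_eq_re (u v : Esp n) : ⟪u, v⟫ = (inner ℂ u v).re := by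
  simp [PiLp.inner_apply, Complex.inner]

lemma inner_smul_conj (z : ℂ) (u v : Esp n) :
    ⟪u, z • v⟫ = ⟪(starRingEnd ℂ) z • u, v⟫ := by
  rw [inner_eq_re, inner_eq_re, inner_smul_right, inner_smul_left, Complex.conj_conj]

lemma inner_I_self (u : Esp n) : ⟪u, Complex.I • u⟫ = 0 := by
  rw [inner_eq_re, inner_smul_right]
  have : (inner ℂ u u : ℂ).im = 0 := inner_self_im (𝕜 := ℂ) u
  rw [Complex.I_mul_re, this, neg_zero]

/-- The basic exponentials. -/
def ee (k : ℤ) (t : ℝ) : ℂ := Complex.exp (2 * Real.pi * k * t * Complex.I)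

@[fun_prop]
lemma ee_cont (k : ℤ) : Continuous (ee k) := by unfold ee; fun_prop

lemma ee_norm (k : ℤ) (t : ℝ) : ‖ee k t‖ = 1 := by
  have : (2 * Real.pi * k * t * Complex.I : ℂ) = ((2 * Real.pi * k * t : ℝ) : ℂ) * Complex.I := by
    push_cast; ring
  rw [ee, this, Complex.norm_exp_ofReal_mul_I]

lemma ee_mul (k l : ℤ) (t : ℝ) : ee k t * ee l t = ee (k + l) t := by
  unfold ee; rw [← Complex.exp_add]; push_cast; ring_nf

lemma ee_conj (k : ℤ) (t : ℝ) : (starRingEnd ℂ) (ee k t) = ee (-k) t := by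
  unfold ee; rw [← Complex.exp_conj]
  have : (starRingEnd ℂ) (2:ℂ) = 2 := Complex.conj_ofNat 2
  simp [this]

lemma ee_zero (t : ℝ) : ee 0 t = 1 := by simp [ee]

lemma ee_hasDerivAt (k : ℤ) (t : ℝ) :
    HasDerivAt (ee k) (2 * Real.pi * k * Complex.I * ee k t) t := by
  have h1 : HasDerivAt (fun s : ℝ => (2 * Real.pi * k * s * Complex.I : ℂ))
      (2 * Real.pi * k * Complex.I) t := by
    have := ((Complex.ofRealCLM.hasDerivAt (x := t)).const_mul (2 * Real.pi * k : ℂ)).mul_const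
      Complex.I
    simpa using this
  have := h1.cexp
  rw [mul_comm (Complex.exp _)] at this
  exact this

lemma ee_period (k : ℤ) (t : ℝ) : ee k (t + 1) = ee k t := by
  unfold ee
  rw [Complex.exp_eq_exp_iff_exists_int]
  exact ⟨k, by push_cast; ring⟩

lemma ee_int (k : ℤ) : ∫ t in (0:ℝ)..1, ee k t = if k = 0 then 1 else 0 := by
  split_ifs with h
  · subst h; simp [ee_zero]
  · have hk : (2 * Real.pi * k * Complex.I : ℂ) ≠ 0 := by
      simp [Real.pi_ne_zero, h]
    have h1 : ∫ t in (0:ℝ)..1, (2 * Real.pi * k * Complex.I * ee k t) = ee k 1 - ee k 0 :=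
      intervalIntegral.integral_eq_sub_of_hasDerivAt (fun t _ => ee_hasDerivAt k t)
        (Continuous.intervalIntegrable (by fun_prop) _ _)
    have h2 : ee k 1 = ee k 0 := by simpa using ee_period k 0
    rw [intervalIntegral.integral_const_mul, h2, sub_self] at h1
    exact (mul_eq_zero.mp h1).resolve_left hk

/-- Fourier coefficients. -/
def fc (k : ℤ) (y : ℝ → Esp n) : Esp n := ∫ t in (0:ℝ)..1, ee (-k) t • y t

variable {ι : Type} [Fintype ι]

/-- The space of coefficients of trigonometric polynomials. -/
abbrev Coef (ι : Type) (n : ℕ) := PiLp 2 (fun _ : ι => Esp n)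

/-- The trigonometric polynomial with given coefficients. -/
def ev (κ : ι → ℤ) (c : Coef ι n) (t : ℝ) : Esp n := ∑ i, ee (κ i) t • c i

lemma ev_cont2 (κ : ι → ℤ) : Continuous fun p : Coef ι n × ℝ => ev κ p.1 p.2 := by
  unfold ev
  refine continuous_finsetSum _ fun i _ => ?_
  have h1 : Continuous fun p : Coef ι n × ℝ => p.1 i :=
    (PiLp.continuous_apply 2 _ i).comp continuous_fst
  have h2 : Continuous fun p : Coef ι n × ℝ => ee (κ i) p.2 := (ee_cont _).comp continuous_snd
  exact h2.smul h1

lemma ev_cont (κ : ι → ℤ) (c : Coef ι n) : Continuous (ev κ c) := by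
  unfold ev
  exact continuous_finsetSum _ fun i _ => (ee_cont _).smul continuous_const

lemma ev_add (κ : ι → ℤ) (c d : Coef ι n) (t : ℝ) : ev κ (c + d) t = ev κ c t + ev κ d t := by
  simp [ev, Finset.sum_add_distrib]

lemma inner_fc (k : ℤ) (y : ℝ → Esp n) (hy : Continuous y) (v : Esp n) :
    ∫ t in (0:ℝ)..1, ⟪y t, ee k t • v⟫ = ⟪fc k y, v⟫ := by
  have h1 : ∀ t, ⟪y t, ee k t • v⟫ = (innerSL ℝ v) (ee (-k) t • y t) := by
    intro t
    rw [inner_smul_conj, ee_conj, innerSL_apply_apply, real_inner_comm]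
  simp_rw [h1]
  have hc : Continuous fun t => ee (-k) t • y t := (ee_cont _).smul hy
  rw [ContinuousLinearMap.intervalIntegral_comp_comm _ (hc.intervalIntegrable _ _),
    innerSL_apply_apply, real_inner_comm, fc]

lemma inner_ev (κ : ι → ℤ) (y : ℝ → Esp n) (hy : Continuous y) (c : Coef ι n) :
    ∫ t in (0:ℝ)..1, ⟪y t, ev κ c t⟫ = ∑ i, ⟪fc (κ i) y, c i⟫ := by
  simp_rw [ev, inner_sum]
  rw [intervalIntegral.integral_finsetSum]
  · exact Finset.sum_congr rfl fun i _ => inner_fc _ y hy _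
  · intro i _
    apply Continuous.intervalIntegrable
    exact hy.inner ((ee_cont _).smul continuous_const)

lemma fc_ev (κ : ι → ℤ) (hκ : Function.Injective κ) (c : Coef ι n) (i : ι) :
    fc (κ i) (ev κ c) = c i := by
  classical
  unfold fc ev
  simp_rw [Finset.smul_sum, smul_smul, ee_mul]
  rw [intervalIntegral.integral_finsetSum]
  · simp_rw [intervalIntegral.integral_smul_const, ee_int]
    rw [Finset.sum_eq_single i]
    · simp
    · intro j _ hj
      have : -κ i + κ j ≠ 0 := fun h => hj (hκ (by omega))
      simp [this]
    · simp
  · intro j _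
    exact (((ee_cont _).smul continuous_const)).intervalIntegrable _ _

lemma parseval (κ : ι → ℤ) (hκ : Function.Injective κ) (c : Coef ι n) :
    ∫ t in (0:ℝ)..1, ‖ev κ c t‖ ^ 2 = ∑ i, ‖c i‖ ^ 2 := by
  simp_rw [← real_inner_self_eq_norm_sq]
  rw [inner_ev κ _ (ev_cont κ c)]
  simp_rw [fc_ev κ hκ]

/-- Bessel's inequality. -/
lemma bessel (κ : ι → ℤ) (hκ : Function.Injective κ) (y : ℝ → Esp n) (hy : Continuous y)
    (M : ℝ) (hM : ∀ t, ‖y t‖ ≤ M) : ∑ i, ‖fc (κ i) y‖ ^ 2 ≤ M ^ 2 := by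
  let d : Coef ι n := WithLp.toLp 2 fun i => fc (κ i) y
  have h1 := inner_ev κ y hy d
  have h2 := parseval κ hκ d
  have h3 : ∀ i, d i = fc (κ i) y := fun i => rfl
  simp_rw [h3, real_inner_self_eq_norm_sq] at h1
  simp_rw [h3] at h2
  have h4 : ∫ t in (0:ℝ)..1, ⟪y t, ev κ d t⟫ ≤
      ∫ t in (0:ℝ)..1, (1 / 2 * M ^ 2 + 1 / 2 * ‖ev κ d t‖ ^ 2) := by
    apply intervalIntegral.integral_mono_on (by norm_num)
    · exact (hy.inner (ev_cont κ d)).intervalIntegrable _ _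
    · have := ev_cont κ d
      exact Continuous.intervalIntegrable (by fun_prop) _ _
    · intro t _
      have h5 := real_inner_le_norm (y t) (ev κ d t)
      nlinarith [hM t, norm_nonneg (y t), norm_nonneg (ev κ d t),
        sq_nonneg (‖y t‖ - ‖ev κ d t‖), norm_nonneg (y t)]
  rw [intervalIntegral.integral_add, intervalIntegral.integral_const_mul,
    intervalIntegral.integral_const_mul, h2, h1] at h4
  · simp at h4; linarith
  · simp
  · have := ev_cont κ d
    exact Continuous.intervalIntegrable (by fun_prop) _ _

/-- A Hamiltonian `K z = (3π/2)‖z‖² + m + k z` satisfying the assumptions needed for the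
existence theorem. -/
structure Ham (n : ℕ) where
  k : Esp n → ℝ
  g : Esp n → Esp n
  m : ℝ
  B : ℝ
  M : ℝ
  lam : ℝ
  δ : ℝ
  hgrad : ∀ z, HasGradientAt k (g z) z
  hk : ∀ z, |k z| ≤ B
  hg : ∀ z, ‖g z‖ ≤ M
  hlam : 0 ≤ lam
  hlip : ∀ z w, ‖g z - g w‖ ≤ lam * ‖z - w‖
  hpos : ∀ z, 0 ≤ 3 * Real.pi / 2 * ‖z‖ ^ 2 + m + k z
  hδ : 0 < δ
  hsmall : ∀ z, ‖z‖ ≤ δ → 3 * Real.pi / 2 * ‖z‖ ^ 2 + m + k z ≤ 1 / 2 * ‖z‖ ^ 2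

/-- The full Hamiltonian. -/
def Ham.K (D : Ham n) (z : Esp n) : ℝ := 3 * Real.pi / 2 * ‖z‖ ^ 2 + D.m + D.k z

lemma Ham.k_cont (D : Ham n) : Continuous D.k :=
  continuous_iff_continuousAt.mpr fun z => (D.hgrad z).continuousAt

lemma Ham.g_cont (D : Ham n) : Continuous D.g := by
  have : LipschitzWith (Real.toNNReal D.lam) D.g := LipschitzWith.of_dist_le_mul fun z w => by
    rw [Real.coe_toNNReal _ D.hlam, dist_eq_norm, dist_eq_norm]; exact D.hlip z w
  exact this.continuous

lemma Ham.M_nonneg (D : Ham n) : 0 ≤ D.M := (norm_nonneg _).trans (D.hg 0)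
lemma Ham.B_nonneg (D : Ham n) : 0 ≤ D.B := (abs_nonneg _).trans (D.hk 0)

lemma Ham.taylor (D : Ham n) (x y : Esp n) :
    D.k x + ⟪D.g x, y⟫ - D.lam * ‖y‖ ^ 2 ≤ D.k (x + y) := by
  have h := (convex_closedBall x ‖y‖).norm_image_sub_le_of_norm_hasFDerivWithin_le
    (f := fun z => D.k z - innerSL ℝ (D.g x) z)
    (f' := fun z => InnerProductSpace.toDual ℝ _ (D.g z) - innerSL ℝ (D.g x))
    (C := D.lam * ‖y‖) (x := x) (y := x + y)
    (fun z _ => ((D.hgrad z).hasFDerivAt.sub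
      (innerSL ℝ (D.g x)).hasFDerivAt).hasFDerivWithinAt)
    (fun z hz => by
      have h1 : InnerProductSpace.toDual ℝ _ (D.g z) - innerSL ℝ (D.g x) =
          InnerProductSpace.toDual ℝ _ (D.g z - D.g x) := by
        ext w; simp
      rw [h1, LinearIsometryEquiv.norm_map]
      refine (D.hlip z x).trans ?_
      have := D.hlam
      gcongr
      rw [← dist_eq_norm]; exact hz)
    (mem_closedBall_self (norm_nonneg _)) (by simp [mem_closedBall, dist_eq_norm])
  simp only [innerSL_apply_apply, inner_add_right, add_sub_cancel_left] at h
  have h2 := (abs_le.mp (by simpa using h : |_| ≤ _)).1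
  nlinarith

/-- The gradient of the reduced action functional. -/
def VV (D : Ham n) (κ : ι → ℤ) (c : Coef ι n) : Coef ι n :=
  WithLp.toLp 2 fun i => (2 * Real.pi * κ i - 3 * Real.pi) • c i - fc (κ i) (fun t => D.g (ev κ c t))

/-- The reduced action functional. -/
def Phi (D : Ham n) (κ : ι → ℤ) (c : Coef ι n) : ℝ :=
  1 / 2 * ∑ i, (2 * Real.pi * κ i - 3 * Real.pi) * ‖c i‖ ^ 2 -
    (∫ t in (0:ℝ)..1, D.k (ev κ c t)) - D.m

lemma coef_cont (i : ι) : Continuous fun c : Coef ι n => c i := PiLp.continuous_apply 2 _ i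

lemma Phi_cont (D : Ham n) (κ : ι → ℤ) : Continuous (Phi D κ : Coef ι n → ℝ) := by
  unfold Phi
  refine ((continuous_const.mul (continuous_finsetSum _ fun i _ => continuous_const.mul
    ((coef_cont i).norm.pow 2))).sub ?_).sub continuous_const
  apply intervalIntegral.continuous_parametric_intervalIntegral_of_continuous'
  exact D.k_cont.comp (ev_cont2 κ)

lemma VV_cont (D : Ham n) (κ : ι → ℤ) : Continuous (VV D κ : Coef ι n → Coef ι n) := by
  unfold VV
  refine (PiLp.continuous_toLp 2 _).comp (continuous_pi fun i => ?_)
  refine Continuous.sub ((coef_cont (n := n) i).const_smul (2 * Real.pi * κ i - 3 * Real.pi)) ?_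
  unfold fc
  apply intervalIntegral.continuous_parametric_intervalIntegral_of_continuous'
  exact ((ee_cont _).comp continuous_snd).smul (D.g_cont.comp (ev_cont2 κ))

lemma VV_inner (D : Ham n) (κ : ι → ℤ) (c d : Coef ι n) :
    ⟪VV D κ c, d⟫ = ∑ i, (2 * Real.pi * κ i - 3 * Real.pi) * ⟪c i, d i⟫ -
      ∫ t in (0:ℝ)..1, ⟪D.g (ev κ c t), ev κ d t⟫ := by
  rw [inner_ev κ (fun t => D.g (ev κ c t)) (D.g_cont.comp (ev_cont κ c)), ← Finset.sum_sub_distrib, PiLp.inner_apply]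
  refine Finset.sum_congr rfl fun i _ => ?_
  simp only [VV]
  rw [inner_sub_left, real_inner_smul_left]

lemma Phi_desc (D : Ham n) (κ : ι → ℤ) (hκ : Function.Injective κ) (c d : Coef ι n) :
    Phi D κ (c + d) ≤ Phi D κ c + ⟪VV D κ c, d⟫ +
      (Real.pi * ∑ i, |(κ i : ℝ)| + D.lam + 1) * ‖d‖ ^ 2 := by
  have hx := ev_cont κ c
  have hy := ev_cont κ d
  have hk := D.k_cont
  have hg := D.g_cont
  have h1 : (∫ t in (0:ℝ)..1, D.k (ev κ c t)) + (∫ t in (0:ℝ)..1, ⟪D.g (ev κ c t), ev κ d t⟫)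
      - D.lam * ∑ i, ‖d i‖ ^ 2 ≤ ∫ t in (0:ℝ)..1, D.k (ev κ (c + d) t) := by
    rw [← parseval κ hκ, ← intervalIntegral.integral_const_mul,
      ← intervalIntegral.integral_add, ← intervalIntegral.integral_sub]
    · apply intervalIntegral.integral_mono_on (by norm_num)
      · exact Continuous.intervalIntegrable (by fun_prop) _ _
      · exact (hk.comp (ev_cont κ _)).intervalIntegrable _ _
      · intro t _
        rw [ev_add]
        exact D.taylor _ _
    all_goals exact Continuous.intervalIntegrable (by fun_prop) _ _
  have h2 : ∑ i, (2 * Real.pi * κ i - 3 * Real.pi) * ‖(c + d) i‖ ^ 2 =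
      ∑ i, (2 * Real.pi * κ i - 3 * Real.pi) * ‖c i‖ ^ 2 +
      2 * ∑ i, (2 * Real.pi * κ i - 3 * Real.pi) * ⟪c i, d i⟫ +
      ∑ i, (2 * Real.pi * κ i - 3 * Real.pi) * ‖d i‖ ^ 2 := by
    rw [Finset.mul_sum, ← Finset.sum_add_distrib, ← Finset.sum_add_distrib]
    refine Finset.sum_congr rfl fun i _ => ?_
    rw [PiLp.add_apply, norm_add_sq_real]; ring
  have h3 : ∑ i, (2 * Real.pi * κ i - 3 * Real.pi) * ‖d i‖ ^ 2 ≤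
      2 * (Real.pi * ∑ i, |(κ i : ℝ)|) * ∑ i, ‖d i‖ ^ 2 := by
    rw [Finset.mul_sum]
    refine Finset.sum_le_sum fun i hi => ?_
    gcongr
    have h4 : (κ i : ℝ) ≤ ∑ i, |(κ i : ℝ)| := (le_abs_self _).trans
      (Finset.single_le_sum (f := fun i => |(κ i : ℝ)|) (fun _ _ => abs_nonneg _) hi)
    nlinarith [Real.pi_pos]
  rw [VV_inner, PiLp.norm_sq_eq_of_L2]
  unfold Phi
  rw [h2]
  have h5 : 0 ≤ ∑ i, ‖d i‖ ^ 2 := Finset.sum_nonneg fun i _ => by positivity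
  nlinarith

lemma coef_gap (k : ℤ) : Real.pi ≤ |2 * Real.pi * k - 3 * Real.pi| := by
  have h1 : (1:ℝ) ≤ |2 * (k:ℝ) - 3| := by
    have : (1:ℤ) ≤ |2 * k - 3| := Int.one_le_abs (by omega)
    exact_mod_cast this
  have : 2 * Real.pi * k - 3 * Real.pi = Real.pi * (2 * k - 3) := by ring
  rw [this, abs_mul, abs_of_pos Real.pi_pos]
  nlinarith [Real.pi_pos]

lemma VV_PS (D : Ham n) (κ : ι → ℤ) (hκ : Function.Injective κ) (c : Coef ι n) :
    Real.pi * ‖c‖ - D.M ≤ ‖VV D κ c‖ := by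
  let p : Coef ι n := WithLp.toLp 2 fun i => (2 * Real.pi * κ i - 3 * Real.pi) • c i
  let r : Coef ι n := WithLp.toLp 2 fun i => fc (κ i) (fun t => D.g (ev κ c t))
  have h1 : VV D κ c = p - r := rfl
  have h2 : ‖r‖ ≤ D.M := by
    apply le_of_sq_le_sq _ D.M_nonneg
    rw [PiLp.norm_sq_eq_of_L2]
    exact bessel κ hκ _ (D.g_cont.comp (ev_cont κ c)) _ fun t => D.hg _
  have h3 : Real.pi * ‖c‖ ≤ ‖p‖ := by
    apply le_of_sq_le_sq _ (norm_nonneg _)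
    rw [mul_pow, PiLp.norm_sq_eq_of_L2, PiLp.norm_sq_eq_of_L2, Finset.mul_sum]
    refine Finset.sum_le_sum fun i _ => ?_
    simp only [p]
    rw [norm_smul, mul_pow, Real.norm_eq_abs]
    gcongr
    exact coef_gap _
  rw [h1]
  linarith [norm_sub_norm_le p r]

lemma Phi_eq (D : Ham n) (κ : ι → ℤ) (hκ : Function.Injective κ) (c : Coef ι n) :
    Phi D κ c = Real.pi * ∑ i, (κ i : ℝ) * ‖c i‖ ^ 2 - ∫ t in (0:ℝ)..1, D.K (ev κ c t) := by
  have hx := ev_cont κ c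
  have hk := D.k_cont
  unfold Phi Ham.K
  rw [intervalIntegral.integral_add, intervalIntegral.integral_add,
    intervalIntegral.integral_const_mul, parseval κ hκ]
  · simp_rw [sub_mul, Finset.sum_sub_distrib, ← Finset.mul_sum, mul_assoc, ← Finset.mul_sum]
    simp
    ring
  all_goals exact Continuous.intervalIntegrable (by fun_prop) _ _

end HZ

namespace HZ
variable {ι : Type} [Fintype ι]

/-! ### Part 4: linking geometry -/

lemma Ham.K_quad (D : Ham n) : ∃ A : ℝ, 1 ≤ A ∧ ∀ z, D.K z ≤ A * ‖z‖ ^ 2 := by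
  have hδ := D.hδ
  have hB := D.B_nonneg
  refine ⟨3 * Real.pi / 2 + (|D.m| + D.B) / D.δ ^ 2 + 1, ?_, fun z => ?_⟩
  · have := Real.pi_pos
    have : 0 ≤ (|D.m| + D.B) / D.δ ^ 2 := by positivity
    linarith
  · by_cases hz : ‖z‖ ≤ D.δ
    · refine (D.hsmall z hz).trans ?_
      gcongr
      have := Real.pi_pos
      have : 0 ≤ (|D.m| + D.B) / D.δ ^ 2 := by positivity
      linarith
    · push Not at hz
      have h1 : |D.m| + D.B ≤ (|D.m| + D.B) / D.δ ^ 2 * ‖z‖ ^ 2 := by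
        rw [div_mul_eq_mul_div, le_div_iff₀ (by positivity)]
        gcongr
      have h2 := le_abs_self D.m
      have h3 := (le_abs_self _).trans (D.hk z)
      unfold Ham.K
      nlinarith [sq_nonneg ‖z‖]

lemma ev_norm_le (κ : ι → ℤ) (c : Coef ι n) (t : ℝ) : ‖ev κ c t‖ ≤ ∑ i, ‖c i‖ := by
  unfold ev
  refine (norm_sum_le _ _).trans (Finset.sum_le_sum fun i _ => ?_)
  rw [norm_smul, ee_norm, one_mul]

lemma gamma_bound (D : Ham n) : ∃ ρ : ℝ, 0 < ρ ∧ ∀ (ι : Type) [Fintype ι] (κ : ι → ℤ),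
    Function.Injective κ → ∀ c : Coef ι n, (∀ i, κ i ≤ 0 → c i = 0) →
    ∑ i, max (κ i : ℝ) 0 * ‖c i‖ ^ 2 = ρ ^ 2 → ρ ^ 2 ≤ Phi D κ c := by
  obtain ⟨A, hA1, hA⟩ := D.K_quad
  have hδ := D.hδ
  obtain ⟨k0, hk0⟩ := exists_nat_gt (4 * A)
  have hk0pos : (0:ℝ) < k0 := by linarith
  refine ⟨D.δ / (2 * k0), by positivity, ?_⟩
  intro ι _ κ hκ c hc hsum
  set ρ := D.δ / (2 * k0) with hρ
  have hρ0 : 0 < ρ := by positivity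
  classical
  let cl : Coef ι n := WithLp.toLp 2 fun i => if κ i ≤ k0 then c i else 0
  let ch : Coef ι n := WithLp.toLp 2 fun i => if κ i ≤ k0 then 0 else c i
  have hcl : ∀ i, cl i = if κ i ≤ k0 then c i else 0 := fun i => rfl
  have hch : ∀ i, ch i = if κ i ≤ k0 then 0 else c i := fun i => rfl
  have hsplit : c = cl + ch := by
    ext1 i
    rw [PiLp.add_apply, hcl, hch]
    split_ifs <;> simp
  have hterm : ∀ i, ‖c i‖ ^ 2 ≤ max (κ i : ℝ) 0 * ‖c i‖ ^ 2 := by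
    intro i
    by_cases h : κ i ≤ 0
    · simp [hc i h]
    · have : (1:ℝ) ≤ κ i := by exact_mod_cast (by omega : 1 ≤ κ i)
      have : 1 ≤ max (κ i : ℝ) 0 := this.trans (le_max_left _ _)
      nlinarith [sq_nonneg ‖c i‖]
  have hnn : ∀ i, 0 ≤ max (κ i : ℝ) 0 * ‖c i‖ ^ 2 := fun i =>
    mul_nonneg (le_max_right _ _) (sq_nonneg _)
  have hci : ∀ i, ‖c i‖ ≤ ρ := by
    intro i
    apply le_of_sq_le_sq _ hρ0.le
    rw [← hsum]
    exact (hterm i).trans (Finset.single_le_sum (f := fun i => max (κ i : ℝ) 0 * ‖c i‖ ^ 2)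
      (fun i _ => hnn i) (Finset.mem_univ i))
  have hy : ∀ t, ‖ev κ cl t‖ ≤ D.δ / 2 := by
    intro t
    refine (ev_norm_le κ cl t).trans ?_
    have h1 : ∑ i, ‖cl i‖ ≤ ∑ i ∈ Finset.univ.filter (fun i => κ i ∈ Finset.Icc (1:ℤ) k0), ρ := by
      rw [Finset.sum_filter]
      refine Finset.sum_le_sum fun i _ => ?_
      rw [hcl]
      by_cases h1 : κ i ≤ k0
      · by_cases h2 : κ i ≤ 0
        · simp [hc i h2]; split_ifs <;> linarith
        · have : κ i ∈ Finset.Icc (1:ℤ) k0 := Finset.mem_Icc.mpr ⟨by omega, h1⟩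
          rw [if_pos h1, if_pos this]; exact hci i
      · rw [if_neg h1]; simp; split_ifs <;> linarith
    refine h1.trans ?_
    rw [Finset.sum_const, nsmul_eq_mul]
    have h2 : (Finset.univ.filter (fun i => κ i ∈ Finset.Icc (1:ℤ) k0)).card ≤ k0 := by
      have := Finset.card_le_card_of_injOn (s := Finset.univ.filter
        (fun i => κ i ∈ Finset.Icc (1:ℤ) k0)) (t := Finset.Icc (1:ℤ) k0) κ
        (fun i hi => by simpa using hi) hκ.injOn
      simpa using this
    calc _ ≤ (k0:ℝ) * ρ := by gcongr
      _ = D.δ / 2 := by rw [hρ]; field_simp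
  have hpt : ∀ t, D.K (ev κ c t) ≤ 1 / 2 * ‖ev κ c t‖ ^ 2 + 4 * A * ‖ev κ ch t‖ ^ 2 := by
    intro t
    have hev : ev κ c t = ev κ cl t + ev κ ch t := by
      conv_lhs => rw [hsplit]
      exact ev_add κ cl ch t
    have htri := norm_add_le (ev κ cl t) (ev κ ch t)
    rw [← hev] at htri
    by_cases hw : ‖ev κ ch t‖ ≤ D.δ / 2
    · have := D.hsmall (ev κ c t) (by linarith [hy t])
      have h2 : 0 ≤ 4 * A * ‖ev κ ch t‖ ^ 2 := by positivity
      unfold Ham.K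
      linarith
    · push Not at hw
      have h1 : ‖ev κ c t‖ ≤ 2 * ‖ev κ ch t‖ := by linarith [hy t]
      calc D.K (ev κ c t) ≤ A * ‖ev κ c t‖ ^ 2 := hA _
        _ ≤ A * (2 * ‖ev κ ch t‖) ^ 2 := by gcongr
        _ ≤ _ := by nlinarith [sq_nonneg ‖ev κ c t‖]
  have hintg : ∫ t in (0:ℝ)..1, D.K (ev κ c t) ≤ 1 / 2 * ∑ i, ‖c i‖ ^ 2 + 4 * A * ∑ i, ‖ch i‖ ^ 2 := by
    have hx := ev_cont κ c
    have hw := ev_cont κ ch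
    have hk := D.k_cont
    rw [← parseval κ hκ, ← parseval κ hκ, ← intervalIntegral.integral_const_mul,
      ← intervalIntegral.integral_const_mul, ← intervalIntegral.integral_add]
    · apply intervalIntegral.integral_mono_on (by norm_num)
      · unfold Ham.K; exact Continuous.intervalIntegrable (by fun_prop) _ _
      · exact Continuous.intervalIntegrable (by fun_prop) _ _
      · intro t _; exact hpt t
    all_goals exact Continuous.intervalIntegrable (by fun_prop) _ _
  have hs1 : ∑ i, ‖c i‖ ^ 2 ≤ ρ ^ 2 := by
    rw [← hsum]; exact Finset.sum_le_sum fun i _ => hterm i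
  have hs2 : 4 * A * ∑ i, ‖ch i‖ ^ 2 ≤ ρ ^ 2 := by
    rw [← hsum, Finset.mul_sum]
    refine Finset.sum_le_sum fun i _ => ?_
    rw [hch]
    split_ifs with h
    · simpa using hnn i
    · gcongr
      have : (k0:ℝ) ≤ κ i := by exact_mod_cast (not_le.mp h).le
      exact hk0.le.trans (this.trans (le_max_left _ _))
  have hs3 : ∑ i, (κ i : ℝ) * ‖c i‖ ^ 2 = ρ ^ 2 := by
    rw [← hsum]
    refine Finset.sum_congr rfl fun i _ => ?_
    by_cases h : κ i ≤ 0
    · simp [hc i h]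
    · have : (0:ℝ) ≤ κ i := by exact_mod_cast (by omega : 0 ≤ κ i)
      rw [max_eq_left this]
  rw [Phi_eq D κ hκ, hs3]
  nlinarith [Real.pi_gt_three, sq_nonneg ρ]

/-- The embedding of the linking disc. -/
def jj [DecidableEq ι] (κ : ι → ℤ) (i1 : ι) (e1 : Esp n)
    (y : ({i // κ i ≤ 0} → Esp n) × ℝ) : Coef ι n :=
  WithLp.toLp 2 fun i => if h : κ i ≤ 0 then y.1 ⟨i, h⟩ else if i = i1 then (max y.2 0) • e1 else 0

/-- The linking projection. -/
def qq (κ : ι → ℤ) (c : Coef ι n) : ({i // κ i ≤ 0} → Esp n) × ℝ :=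
  (fun i => c i.1, Real.sqrt (∑ i, max (κ i : ℝ) 0 * ‖c i‖ ^ 2))

lemma galerkin_step (hn : 1 ≤ n) (D : Ham n) : ∃ β : ℝ, 0 < β ∧ ∀ (ι : Type) [Fintype ι]
    (κ : ι → ℤ), Function.Injective κ → ∀ i1 : ι, κ i1 = 1 →
    ∃ c : Coef ι n, VV D κ c = 0 ∧ β ≤ Phi D κ c := by
  obtain ⟨ρ, hρ, hgam⟩ := gamma_bound D
  refine ⟨ρ ^ 2, by positivity, ?_⟩
  intro ι _ κ hκ i1 hi1
  classical
  let e1 : Esp n := EuclideanSpace.single ⟨0, hn⟩ 1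
  have he1 : ‖e1‖ = 1 := by simp [e1]
  have hi1n : ¬ κ i1 ≤ 0 := by omega
  have hj0 : ∀ y i (h : κ i ≤ 0), jj κ i1 e1 y i = y.1 ⟨i, h⟩ := fun y i h => by simp [jj, h]
  have hj1 : ∀ y, jj κ i1 e1 y i1 = (max y.2 0) • e1 := fun y => by simp [jj, hi1n]
  have hj2 : ∀ y i, ¬ κ i ≤ 0 → i ≠ i1 → jj κ i1 e1 y i = 0 := fun y i h h' => by simp [jj, h, h']
  have hjc : Continuous (jj κ i1 e1) := by
    unfold jj
    refine (PiLp.continuous_toLp 2 _).comp (continuous_pi fun i => ?_)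
    by_cases h : κ i ≤ 0
    · simp only [h, dite_true]
      exact (continuous_apply _).comp continuous_fst
    · simp only [h, dite_false]
      by_cases h' : i = i1
      · simp only [h', if_true]
        exact (continuous_snd.max continuous_const).smul continuous_const
      · simp only [h', if_false]; exact continuous_const
  have hqc : Continuous (qq κ : Coef ι n → _) := by
    unfold qq
    refine Continuous.prodMk (continuous_pi fun i => coef_cont _) (Real.continuous_sqrt.comp ?_)
    exact continuous_finsetSum _ fun i _ => continuous_const.mul ((coef_cont i).norm.pow 2)
  have hsum : ∀ y, ∑ i, max (κ i : ℝ) 0 * ‖jj κ i1 e1 y i‖ ^ 2 = (max y.2 0) ^ 2 := by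
    intro y
    rw [Finset.sum_eq_single i1]
    · rw [hj1, norm_smul, he1, hi1, Real.norm_of_nonneg (le_max_right _ _)]; simp
    · intro i _ hi
      by_cases h : κ i ≤ 0
      · have : (κ i : ℝ) ≤ 0 := by exact_mod_cast h
        simp [max_eq_right this]
      · simp [hj2 y i h hi]
    · simp
  have hqj : ∀ y, 0 ≤ y.2 → qq κ (jj κ i1 e1 y) = y := by
    intro y hy
    refine Prod.ext ?_ ?_
    · ext1 i; exact hj0 y i.1 i.2
    · simp only [qq]; rw [hsum, max_eq_left hy, Real.sqrt_sq hy]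
  -- nonpositivity
  have hneg : ∀ y, y.2 ≤ 0 → Phi D κ (jj κ i1 e1 y) ≤ 0 := by
    intro y hy
    rw [Phi_eq D κ hκ]
    have h1 : ∑ i, (κ i : ℝ) * ‖jj κ i1 e1 y i‖ ^ 2 ≤ 0 := by
      refine Finset.sum_nonpos fun i _ => ?_
      by_cases h : κ i ≤ 0
      · have : (κ i : ℝ) ≤ 0 := by exact_mod_cast h
        exact mul_nonpos_of_nonpos_of_nonneg this (sq_nonneg _)
      · by_cases h' : i = i1
        · subst h'; rw [hj1, max_eq_right hy]; simp
        · simp [hj2 y i h h']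
    have h2 : 0 ≤ ∫ t in (0:ℝ)..1, D.K (ev κ (jj κ i1 e1 y) t) :=
      intervalIntegral.integral_nonneg (by norm_num) fun t _ => D.hpos _
    nlinarith [Real.pi_pos]
  have hquad : ∀ y, Phi D κ (jj κ i1 e1 y) ≤
      -(Real.pi / 2) * ‖jj κ i1 e1 y‖ ^ 2 + (D.B - D.m) := by
    intro y
    unfold Phi
    have h1 : ∑ i, (2 * Real.pi * κ i - 3 * Real.pi) * ‖jj κ i1 e1 y i‖ ^ 2 ≤
        -Real.pi * ‖jj κ i1 e1 y‖ ^ 2 := by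
      rw [PiLp.norm_sq_eq_of_L2, Finset.mul_sum]
      refine Finset.sum_le_sum fun i _ => ?_
      by_cases h : κ i ≤ 1
      · have : (κ i : ℝ) ≤ 1 := by exact_mod_cast h
        gcongr
        nlinarith [Real.pi_pos]
      · have h' : i ≠ i1 := fun h' => by subst h'; omega
        simp [hj2 y i (by omega) h']
    have hk := D.k_cont
    have hx := ev_cont κ (jj κ i1 e1 y)
    have h2 : ∫ t in (0:ℝ)..1, (-D.B) ≤ ∫ t in (0:ℝ)..1, D.k (ev κ (jj κ i1 e1 y) t) := by
      apply intervalIntegral.integral_mono_on (by norm_num)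
      · simp
      · exact Continuous.intervalIntegrable (by fun_prop) _ _
      · intro t _; exact (abs_le.mp (D.hk _)).1
    simp at h2
    linarith
  have hnorm : ∀ y, 0 ≤ y.2 → ‖y‖ ≤ ‖jj κ i1 e1 y‖ := by
    intro y hy
    rw [Prod.norm_def]
    refine max_le ?_ ?_
    · refine (pi_norm_le_iff_of_nonneg (norm_nonneg _)).mpr fun i => ?_
      rw [← hj0 y i.1 i.2]
      exact PiLp.norm_apply_le _ _
    · have := PiLp.norm_apply_le (jj κ i1 e1 y) i1
      rw [hj1, norm_smul, he1, mul_one, max_eq_left hy] at this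
      exact this
  refine minimax (Phi D κ) (VV D κ) (Phi_cont D κ) (VV_cont D κ)
    (Real.pi * ∑ i, |(κ i : ℝ)| + D.lam + 1) ?_ (Phi_desc D κ hκ) Real.pi Real.pi_pos D.M
    (VV_PS D κ hκ) (ρ ^ 2) (by positivity) (jj κ i1 e1) (qq κ) hjc hqc (0, ρ)
    (hqj _ hρ.le) (|D.B - D.m| + 1) ?_ ?_ ?_
  · have : 0 ≤ ∑ i, |(κ i : ℝ)| := Finset.sum_nonneg fun _ _ => abs_nonneg _
    have := D.hlam
    have := Real.pi_pos
    positivity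
  · intro y hy
    rcases le_total y.2 0 with h | h
    · exact hneg y h
    · have h1 := hnorm y h
      have h2 := hquad y
      have h3 : |D.B - D.m| + 1 ≤ ‖jj κ i1 e1 y‖ ^ 2 := by
        nlinarith [abs_nonneg (D.B - D.m)]
      nlinarith [Real.pi_gt_three, le_abs_self (D.B - D.m), abs_nonneg (D.B - D.m)]
  · intro y hy
    apply hqj
    by_contra h
    exact absurd (hneg y (not_le.mp h).le) (not_le.mpr hy)
  · intro c hc
    have h1 := congrArg Prod.fst hc
    have h2 := congrArg Prod.snd hc
    simp only [qq] at h1 h2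
    refine hgam ι κ hκ c (fun i hi => ?_) ?_
    · exact congrFun h1 ⟨i, hi⟩
    · rw [← h2, Real.sq_sqrt]
      exact Finset.sum_nonneg fun i _ => mul_nonneg (le_max_right _ _) (sq_nonneg _)

end HZ

namespace HZ
variable {ι : Type} [Fintype ι]

/-! ### Part 5: passing to the limit -/

lemma ev_hasDerivAt (κ : ι → ℤ) (c : Coef ι n) (t : ℝ) :
    HasDerivAt (ev κ c)
      (ev κ (WithLp.toLp 2 fun i => (2 * Real.pi * κ i * Complex.I : ℂ) • c i) t) t := by
  unfold ev
  refine HasDerivAt.fun_sum fun i _ => ?_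
  have := (ee_hasDerivAt (κ i) t).smul_const (c i)
  convert this using 1
  simp only [smul_smul]
  congr 1; ring

lemma gap4 (k : ℤ) : |2 * Real.pi * k| ≤ 4 * |2 * Real.pi * k - 3 * Real.pi| := by
  have h1 : |(k:ℝ)| ≤ 2 * |2 * (k:ℝ) - 3| := by
    have : |k| ≤ 2 * |2 * k - 3| := by
      rcases abs_cases k with h | h <;> rcases abs_cases (2 * k - 3) with h' | h' <;> omega
    exact_mod_cast this
  have : 2 * Real.pi * k - 3 * Real.pi = Real.pi * (2 * k - 3) := by ring
  rw [this, abs_mul, abs_mul, abs_mul, abs_of_pos Real.pi_pos, abs_two]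
  nlinarith [Real.pi_pos]

lemma ev_bounds (D : Ham n) (κ : ι → ℤ) (hκ : Function.Injective κ) (c : Coef ι n)
    (hc : VV D κ c = 0) :
    (∀ ε > 0, ∀ s ∈ Icc (0:ℝ) 1, ∀ t ∈ Icc (0:ℝ) 1,
      ‖ev κ c t - ev κ c s‖ ≤ ε * (16 * D.M ^ 2) + |t - s| / ε) ∧
    (∀ t ∈ Icc (0:ℝ) 1, ‖ev κ c t‖ ≤ 17 * D.M ^ 2 + 2) := by
  set d : Coef ι n := WithLp.toLp 2 fun i => (2 * Real.pi * κ i * Complex.I : ℂ) • c i with hd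
  have hb := bessel κ hκ (fun t => D.g (ev κ c t)) (D.g_cont.comp (ev_cont κ c)) D.M
    fun t => D.hg _
  have hfc : ∀ i, fc (κ i) (fun t => D.g (ev κ c t)) = (2 * Real.pi * κ i - 3 * Real.pi) • c i := by
    intro i
    have h1 : VV D κ c i = 0 := by rw [hc]; rfl
    simp only [VV] at h1
    exact (sub_eq_zero.mp h1).symm
  simp_rw [hfc, norm_smul, mul_pow, Real.norm_eq_abs] at hb
  have hd2 : ∑ i, ‖d i‖ ^ 2 ≤ 16 * D.M ^ 2 := by
    refine le_trans ?_ (mul_le_mul_of_nonneg_left hb (by norm_num : (0:ℝ) ≤ 16))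
    rw [Finset.mul_sum]
    refine Finset.sum_le_sum fun i _ => ?_
    have h1 : ‖d i‖ = |2 * Real.pi * κ i| * ‖c i‖ := by
      have : (2 * Real.pi * κ i * Complex.I : ℂ) = ((2 * Real.pi * κ i : ℝ) : ℂ) * Complex.I := by
        push_cast; ring
      simp only [hd]
      rw [norm_smul, this, norm_mul, Complex.norm_I, mul_one, Complex.norm_real, Real.norm_eq_abs]
    rw [h1, mul_pow]
    have h2 := gap4 (κ i)
    have h3 : |2 * Real.pi * κ i| ^ 2 ≤ (4 * |2 * Real.pi * κ i - 3 * Real.pi|) ^ 2 := by gcongr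
    nlinarith [sq_nonneg ‖c i‖]
  have hc2 : ∑ i, ‖c i‖ ^ 2 ≤ D.M ^ 2 := by
    refine le_trans ?_ hb
    refine Finset.sum_le_sum fun i _ => ?_
    have h1 := coef_gap (κ i)
    have h2 : (1:ℝ) ≤ |2 * Real.pi * κ i - 3 * Real.pi| := by linarith [Real.pi_gt_three]
    exact le_mul_of_one_le_left (sq_nonneg _) (one_le_pow₀ h2)
  have hdc := ev_cont κ d
  have hcc := ev_cont κ c
  have main : ∀ ε > 0, ∀ s ∈ Icc (0:ℝ) 1, ∀ t ∈ Icc (0:ℝ) 1, s ≤ t →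
      ‖ev κ c t - ev κ c s‖ ≤ ε * (16 * D.M ^ 2) + |t - s| / ε := by
    intro ε hε s hs t ht hst
    have h1 : ∫ u in s..t, ev κ d u = ev κ c t - ev κ c s :=
      intervalIntegral.integral_eq_sub_of_hasDerivAt (fun u _ => ev_hasDerivAt κ c u)
        (hdc.intervalIntegrable _ _)
    rw [← h1]
    calc ‖∫ u in s..t, ev κ d u‖ ≤ ∫ u in s..t, ‖ev κ d u‖ :=
          intervalIntegral.norm_integral_le_integral_norm hst
      _ ≤ ∫ u in s..t, (ε * ‖ev κ d u‖ ^ 2 + 1 / ε) := by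
          apply intervalIntegral.integral_mono_on hst
          · exact Continuous.intervalIntegrable (by fun_prop) _ _
          · exact Continuous.intervalIntegrable (by fun_prop) _ _
          · intro u _
            have h3 : 0 ≤ (ε * ‖ev κ d u‖ - 1) ^ 2 / ε := by positivity
            have h4 : (ε * ‖ev κ d u‖ - 1) ^ 2 / ε =
              ε * ‖ev κ d u‖ ^ 2 + 1 / ε - 2 * ‖ev κ d u‖ := by field_simp; ring
            linarith [norm_nonneg (ev κ d u)]
      _ = ε * (∫ u in s..t, ‖ev κ d u‖ ^ 2) + (t - s) / ε := by
          rw [intervalIntegral.integral_add, intervalIntegral.integral_const_mul]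
          · simp; ring
          all_goals exact Continuous.intervalIntegrable (by fun_prop) _ _
      _ ≤ _ := by
          have h5 : ∫ u in s..t, ‖ev κ d u‖ ^ 2 ≤ ∫ u in (0:ℝ)..1, ‖ev κ d u‖ ^ 2 := by
            apply intervalIntegral.integral_mono_interval hs.1 hst ht.2
            · exact Filter.Eventually.of_forall fun u => by positivity
            · exact Continuous.intervalIntegrable (by fun_prop) _ _
          rw [parseval κ hκ] at h5
          rw [abs_of_nonneg (by linarith)]
          gcongr
          linarith
  have main2 : ∀ ε > 0, ∀ s ∈ Icc (0:ℝ) 1, ∀ t ∈ Icc (0:ℝ) 1,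
      ‖ev κ c t - ev κ c s‖ ≤ ε * (16 * D.M ^ 2) + |t - s| / ε := by
    intro ε hε s hs t ht
    rcases le_total s t with h | h
    · exact main ε hε s hs t ht h
    · rw [norm_sub_rev, abs_sub_comm]; exact main ε hε t ht s hs h
  refine ⟨main2, fun t ht => ?_⟩
  have h6 : ∫ s in (0:ℝ)..1, ‖ev κ c t‖ ≤ ∫ s in (0:ℝ)..1, (‖ev κ c s‖ ^ 2 + (16 * D.M ^ 2 + 2)) := by
    apply intervalIntegral.integral_mono_on (by norm_num)
    · simp
    · exact Continuous.intervalIntegrable (by fun_prop) _ _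
    · intro s hs
      have h7 := main2 1 one_pos s hs t ht
      have h8 : |t - s| ≤ 1 := by
        rw [abs_le]; constructor <;> linarith [hs.1, hs.2, ht.1, ht.2]
      have h9 := norm_sub_norm_le (ev κ c t) (ev κ c s)
      nlinarith [sq_nonneg (‖ev κ c s‖ - 1), norm_nonneg (ev κ c s)]
  rw [intervalIntegral.integral_add, parseval κ hκ] at h6
  · simp at h6; linarith
  all_goals exact Continuous.intervalIntegrable (by fun_prop) _ _

lemma fc_tendsto (y : ℕ → ℝ → Esp n) (hy : ∀ j, Continuous (y j)) (x : ℝ → Esp n)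
    (B : ℝ) (hB : ∀ j, ∀ t ∈ Icc (0:ℝ) 1, ‖y j t‖ ≤ B)
    (hlim : ∀ t ∈ Icc (0:ℝ) 1, Filter.Tendsto (fun j => y j t) Filter.atTop (𝓝 (x t))) (k : ℤ) :
    Filter.Tendsto (fun j => fc k (y j)) Filter.atTop (𝓝 (fc k x)) := by
  unfold fc
  apply intervalIntegral.tendsto_integral_filter_of_dominated_convergence (fun _ => B)
  · exact Filter.Eventually.of_forall fun j =>
      ((ee_cont _).smul (hy j)).aestronglyMeasurable
  · refine Filter.Eventually.of_forall fun j => Filter.Eventually.of_forall fun t ht => ?_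
    rw [norm_smul, ee_norm, one_mul]
    rw [uIoc_of_le zero_le_one] at ht
    exact hB j t ⟨ht.1.le, ht.2⟩
  · simp
  · refine Filter.Eventually.of_forall fun t ht => ?_
    rw [uIoc_of_le zero_le_one] at ht
    exact (hlim t ⟨ht.1.le, ht.2⟩).const_smul _

/-- Frequencies from `-(N+1)` to `N+1`. -/
abbrev Idx (N : ℕ) : Type := Finset.Icc (-(N+1:ℤ)) (N+1)

/-- The frequency map. -/
def kap (N : ℕ) (i : Idx N) : ℤ := i.1

lemma kap_inj (N : ℕ) : Function.Injective (kap N) := Subtype.val_injective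

lemma limit_exists (hn : 1 ≤ n) (D : Ham n) : ∃ x : ℝ → Esp n, Continuous x ∧ x 0 = x 1 ∧
    (∀ k : ℤ, (2 * Real.pi * k - 3 * Real.pi) • fc k x = fc k (fun t => D.g (x t))) ∧
    0 < ∫ t in (0:ℝ)..1, (1 / 2 * ⟪D.g (x t), x t⟫ - D.k (x t) - D.m) := by
  obtain ⟨β, hβ, hG⟩ := galerkin_step hn D
  have hG' : ∀ N : ℕ, ∃ c : Coef (Idx N) n,
      VV D (kap N) c = 0 ∧ β ≤ Phi D (kap N) c := fun N =>
    hG _ _ (kap_inj N) ⟨1, by simp only [Finset.mem_Icc]; omega⟩ rfl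
  choose c hc hΦ using hG'
  have hb := fun N => ev_bounds D _ (kap_inj N) (c N) (hc N)
  set y : ℕ → ℝ → Esp n := fun N => ev (kap N) (c N) with hy
  have hyc : ∀ N, Continuous (y N) := fun N => ev_cont _ _
  let f : ℕ → BoundedContinuousFunction (Icc (0:ℝ) 1) (Esp n) := fun N =>
    BoundedContinuousFunction.mkOfCompact ⟨fun t => y N t, (hyc N).comp continuous_subtype_val⟩
  have hfy : ∀ N (t : Icc (0:ℝ) 1), f N t = y N t := fun N t => rfl
  have hcomp : IsCompact (closure (range f)) := by
    apply BoundedContinuousFunction.arzela_ascoli (closedBall (0 : Esp n) (17 * D.M ^ 2 + 2))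
      (isCompact_closedBall _ _)
    · rintro _ t ⟨N, rfl⟩
      rw [mem_closedBall_zero_iff, hfy]
      exact (hb N).2 t t.2
    · intro t0
      rw [Metric.equicontinuousAt_iff]
      intro ε hε
      set η := ε / (2 * (16 * D.M ^ 2 + 1)) with hη
      have hη0 : 0 < η := by positivity
      refine ⟨η * (ε / 2), by positivity, ?_⟩
      rintro t ht ⟨_, N, rfl⟩
      have h1 := (hb N).1 η hη0 t t.2 t0 t0.2
      change dist (f N t0) (f N t) < ε
      rw [hfy, hfy, dist_eq_norm]
      refine lt_of_le_of_lt h1 ?_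
      have h2 : |(t0:ℝ) - t| < η * (ε / 2) := by
        rw [abs_sub_comm]; exact ht
      have h3 : |(t0:ℝ) - t| / η < ε / 2 := by
        rw [div_lt_iff₀ hη0]; linarith
      have h4 : η * (16 * D.M ^ 2) ≤ ε / 2 := by
        have : η * (16 * D.M ^ 2 + 1) = ε / 2 := by rw [hη]; field_simp
        nlinarith
      linarith
  obtain ⟨F, -, φ, hφ, hlim⟩ := hcomp.tendsto_subseq (fun N => subset_closure (mem_range_self N))
  set x : ℝ → Esp n := fun t => F (projIcc 0 1 zero_le_one t) with hx
  have hxc : Continuous x := F.continuous.comp continuous_projIcc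
  have hpt : ∀ t ∈ Icc (0:ℝ) 1,
      Filter.Tendsto (fun j => y (φ j) t) Filter.atTop (𝓝 (x t)) := by
    intro t ht
    have h1 := ((continuous_eval_const (F := BoundedContinuousFunction (Icc (0:ℝ) 1) (Esp n))
      (⟨t, ht⟩ : Icc (0:ℝ) 1)).tendsto F).comp hlim
    simp only [hx]
    rw [projIcc_of_mem _ ht]
    exact h1
  have hbd : ∀ j, ∀ t ∈ Icc (0:ℝ) 1, ‖y (φ j) t‖ ≤ 17 * D.M ^ 2 + 2 := fun j => (hb (φ j)).2
  refine ⟨x, hxc, ?_, ?_, ?_⟩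
  · have h0 := hpt 0 (by simp)
    have h1 := hpt 1 (by simp)
    refine tendsto_nhds_unique h0 (h1.congr fun j => ?_)
    simp only [hy, ev]
    refine Finset.sum_congr rfl fun i _ => ?_
    have := ee_period (kap _ i) 0
    rw [zero_add] at this
    rw [this]
  · intro k
    have h1 := (fc_tendsto (fun j => y (φ j)) (fun j => hyc _) x _ hbd hpt k).const_smul
      (2 * Real.pi * k - 3 * Real.pi)
    have h2 := fc_tendsto (fun j t => D.g (y (φ j) t)) (fun j => D.g_cont.comp (hyc _))
      (fun t => D.g (x t)) D.M (fun j t _ => D.hg _)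
      (fun t ht => (D.g_cont.tendsto _).comp (hpt t ht)) k
    refine tendsto_nhds_unique (h1.congr' ?_) h2
    filter_upwards [Filter.eventually_ge_atTop k.natAbs] with j hj
    have hj2 : k.natAbs ≤ φ j := hj.trans (hφ.id_le j)
    let i : Idx (φ j) := ⟨k, by simp only [Finset.mem_Icc]; omega⟩
    have h3 : VV D (kap (φ j)) (c (φ j)) i = 0 := by rw [hc]; rfl
    simp only [VV] at h3
    have h4 := fc_ev (kap (φ j)) (kap_inj _)
      (c (φ j)) i
    rw [← h4] at h3
    exact sub_eq_zero.mp h3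
  · have h1 : Filter.Tendsto (fun j => ∫ t in (0:ℝ)..1,
        (1 / 2 * ⟪D.g (y (φ j) t), y (φ j) t⟫ - D.k (y (φ j) t) - D.m)) Filter.atTop
        (𝓝 (∫ t in (0:ℝ)..1, (1 / 2 * ⟪D.g (x t), x t⟫ - D.k (x t) - D.m))) := by
      have hk := D.k_cont
      have hg := D.g_cont
      apply intervalIntegral.tendsto_integral_filter_of_dominated_convergence
        (fun _ => 1 / 2 * (D.M * (17 * D.M ^ 2 + 2)) + D.B + |D.m|)
      · refine Filter.Eventually.of_forall fun j => Continuous.aestronglyMeasurable ?_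
        have := hyc (φ j)
        fun_prop
      · refine Filter.Eventually.of_forall fun j => Filter.Eventually.of_forall fun t ht => ?_
        rw [uIoc_of_le zero_le_one] at ht
        have h5 := hbd j t ⟨ht.1.le, ht.2⟩
        have h6 := abs_real_inner_le_norm (D.g (y (φ j) t)) (y (φ j) t)
        have h7 : ‖D.g (y (φ j) t)‖ * ‖y (φ j) t‖ ≤ D.M * (17 * D.M ^ 2 + 2) := by
          have := D.M_nonneg
          gcongr
          exact D.hg _
        have h8 := abs_le.mp (h6.trans h7)
        have h9 := abs_le.mp (D.hk (y (φ j) t))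
        have h10 := abs_le.mp (le_refl |D.m|)
        rw [Real.norm_eq_abs, abs_le]
        constructor <;> linarith [h8.1, h8.2, h9.1, h9.2, h10.1, h10.2]
      · simp
      · refine Filter.Eventually.of_forall fun t ht => ?_
        rw [uIoc_of_le zero_le_one] at ht
        have hc2 : Continuous fun z => 1 / 2 * ⟪D.g z, z⟫ - D.k z - D.m := by fun_prop
        exact (hc2.tendsto (x t)).comp (hpt t ⟨ht.1.le, ht.2⟩)
    refine lt_of_lt_of_le hβ (ge_of_tendsto h1 (Filter.Eventually.of_forall fun j => ?_))
    refine (hΦ (φ j)).trans (le_of_eq ?_)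
    have h2 := VV_inner D (kap (φ j)) (c (φ j)) (c (φ j))
    rw [hc, inner_zero_left] at h2
    simp_rw [real_inner_self_eq_norm_sq] at h2
    have h3 : ∑ i : Idx (φ j), (2 * Real.pi * (kap (φ j) i) - 3 * Real.pi) *
      ‖c (φ j) i‖ ^ 2 = ∫ t in (0:ℝ)..1, ⟪D.g (y (φ j) t), y (φ j) t⟫ := by
      linarith
    have hk := D.k_cont
    have hg := D.g_cont
    have := hyc (φ j)
    unfold Phi
    rw [h3, intervalIntegral.integral_sub, intervalIntegral.integral_sub,
      intervalIntegral.integral_const_mul]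
    · simp [hy]
    all_goals exact Continuous.intervalIntegrable (by fun_prop) _ _

end HZ

namespace HZ

/-! ### Part 6: regularity of the limit -/

lemma scalar_unique (f : ℝ → ℂ) (hf : Continuous f) (h01 : f 0 = f 1)
    (h : ∀ k : ℤ, ∫ t in (0:ℝ)..1, ee (-k) t * f t = 0) : ∀ t ∈ Icc (0:ℝ) 1, f t = 0 := by
  have : Fact ((0:ℝ) < 1) := ⟨one_pos⟩
  let F : C(AddCircle (1:ℝ), ℂ) := ⟨AddCircle.liftIoc 1 0 f,
    AddCircle.liftIoc_continuous (by simpa using h01) hf.continuousOn⟩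
  have hF : ∀ t ∈ Ioc (0:ℝ) 1, F (t : AddCircle (1:ℝ)) = f t := fun t ht =>
    AddCircle.liftIoc_zero_coe_apply ht
  have hco : ∀ k, fourierCoeff F k = 0 := by
    intro k
    rw [fourierCoeff_eq_intervalIntegral _ _ 0]
    have : ∫ x in (0:ℝ)..0+1, fourier (-k) (x : AddCircle (1:ℝ)) • F (x : AddCircle (1:ℝ)) = 0 := by
      rw [← h k, zero_add]
      apply intervalIntegral.integral_congr_ae
      refine Filter.Eventually.of_forall fun t ht => ?_
      rw [uIoc_of_le zero_le_one] at ht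
      rw [hF t ht, fourier_coe_apply, smul_eq_mul]
      congr 1
      unfold ee
      congr 1
      push_cast
      ring
    rw [this, smul_zero]
  have hz : ∀ x, F x = 0 := by
    intro x
    have h1 := has_pointwise_sum_fourier_series_of_summable (f := F)
      (by simp_rw [show fourierCoeff F = fun _ => 0 from funext hco]; exact summable_zero) x
    simp_rw [hco, zero_smul] at h1
    exact h1.unique hasSum_zero
  have hI : ∀ t ∈ Ioc (0:ℝ) 1, f t = 0 := fun t ht => by rw [← hF t ht, hz]
  intro t ht
  rcases eq_or_lt_of_le ht.1 with h0 | h0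
  · rw [← h0, h01]; exact hI 1 (by simp)
  · exact hI t ⟨h0, ht.2⟩

lemma fc_unique (z : ℝ → Esp n) (hz : Continuous z) (h01 : z 0 = z 1)
    (h : ∀ k, fc k z = 0) : ∀ t ∈ Icc (0:ℝ) 1, z t = 0 := by
  intro t ht
  ext j
  refine scalar_unique (fun t => z t j) (by fun_prop) (by rw [h01]) (fun k => ?_) t ht
  have h1 := congrArg (EuclideanSpace.proj (𝕜 := ℂ) j) (h k)
  unfold fc at h1
  rw [← ContinuousLinearMap.intervalIntegral_comp_comm] at h1
  · simpa using h1
  · exact ((ee_cont _).smul hz).intervalIntegrable _ _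

lemma fc_sub (k : ℤ) (y z : ℝ → Esp n) (hy : Continuous y) (hz : Continuous z) :
    fc k (fun t => y t - z t) = fc k y - fc k z := by
  unfold fc
  simp_rw [smul_sub]
  exact intervalIntegral.integral_sub (((ee_cont _).smul hy).intervalIntegrable _ _)
    (((ee_cont _).smul hz).intervalIntegrable _ _)

lemma fc_const (k : ℤ) (a : Esp n) : fc k (fun _ => a) = if k = 0 then a else 0 := by
  unfold fc
  rw [intervalIntegral.integral_smul_const, ee_int]
  by_cases h : k = 0 <;> simp [h]

lemma regularity (x h : ℝ → Esp n) (hx : Continuous x) (hh : Continuous h) (h01 : x 0 = x 1)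
    (hk : ∀ k : ℤ, (2 * Real.pi * k : ℂ) • fc k x = fc k h) :
    (∫ t in (0:ℝ)..1, Complex.I • h t) = 0 ∧
    ∀ t ∈ Icc (0:ℝ) 1, x t = x 0 + ∫ s in (0:ℝ)..t, Complex.I • h s := by
  have hIh : Continuous fun t => Complex.I • h t := by fun_prop
  set y : ℝ → Esp n := fun t => ∫ s in (0:ℝ)..t, Complex.I • h s with hy
  have hyd : ∀ t, HasDerivAt y (Complex.I • h t) t := fun t =>
    intervalIntegral.integral_hasDerivAt_right (hIh.intervalIntegrable _ _)
      hIh.aestronglyMeasurable.stronglyMeasurableAtFilter hIh.continuousAt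
  have hyc : Continuous y := continuous_iff_continuousAt.mpr fun t => (hyd t).continuousAt
  have hy0 : y 0 = 0 := by simp [hy]
  have hy1 : y 1 = 0 := by
    have h1 := hk 0
    simp only [hy]
    rw [intervalIntegral.integral_smul]
    simp [fc, ee_zero] at h1
    rw [← h1, smul_zero]
  refine ⟨hy1, ?_⟩
  have hfy : ∀ k : ℤ, k ≠ 0 → fc k y = fc k x := by
    intro k hk0
    have h1 : ∫ t in (0:ℝ)..1, (ee (-k) t • (Complex.I • h t) +
        (2 * Real.pi * ((-k : ℤ) : ℂ) * Complex.I * ee (-k) t) • y t) =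
        ee (-k) 1 • y 1 - ee (-k) 0 • y 0 := by
      refine intervalIntegral.integral_eq_sub_of_hasDerivAt
        (f := fun t => ee (-k) t • y t) (fun t _ => ?_) ?_
      · exact (ee_hasDerivAt (-k) t).smul (hyd t)
      · exact Continuous.intervalIntegrable (by fun_prop) _ _
    rw [hy0, hy1, smul_zero, smul_zero, sub_zero, intervalIntegral.integral_add] at h1
    · simp_rw [mul_smul _ (ee _ _), smul_comm (ee _ _) Complex.I] at h1
      rw [intervalIntegral.integral_smul, intervalIntegral.integral_smul] at h1
      change Complex.I • fc k h + _ • fc k y = 0 at h1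
      rw [← hk k, smul_smul] at h1
      have h2 : (2 * Real.pi * k * Complex.I : ℂ) • (fc k x - fc k y) = 0 := by
        rw [← h1]; push_cast; module
      have h3 : (2 * Real.pi * k * Complex.I : ℂ) ≠ 0 := by simp [Real.pi_ne_zero, hk0]
      exact (sub_eq_zero.mp ((smul_eq_zero.mp h2).resolve_left h3)).symm
    all_goals exact Continuous.intervalIntegrable (by fun_prop) _ _
  set a : Esp n := fc 0 x - fc 0 y with ha
  have hz := fc_unique (fun t => (x t - y t) - a) (by fun_prop) (by simp only [hy0, hy1, h01])
    (fun k => by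
      rw [fc_sub k _ _ (by fun_prop) continuous_const, fc_sub k _ _ hx hyc, fc_const]
      split_ifs with h0
      · rw [h0, ha, sub_self]
      · rw [hfy k h0]; simp)
  have h0 := hz 0 (by simp)
  simp only [hy0, sub_zero] at h0
  intro t ht
  have h1 := hz t ht
  rw [sub_eq_zero.mp h0, ← sub_eq_zero, ← h1]
  abel

theorem exists_orbit (hn : 1 ≤ n) (D : Ham n) : ∃ x : ℝ → Esp n, (∀ t, x (t + 1) = x t) ∧
    (∀ t, HasDerivAt x (Complex.I • ((3 * Real.pi) • x t + D.g (x t))) t) ∧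
    0 < ∫ t in (0:ℝ)..1, (1 / 2 * ⟪D.g (x t), x t⟫ - D.k (x t) - D.m) := by
  obtain ⟨x, hx, h01, hk, hpos⟩ := limit_exists hn D
  have hg := D.g_cont
  set h : ℝ → Esp n := fun t => (3 * Real.pi) • x t + D.g (x t) with hh
  have hhc : Continuous h := by fun_prop
  have hreg := regularity x h hx hhc h01 (fun k => by
    have h1 : fc k h = (3 * Real.pi) • fc k x + fc k (fun t => D.g (x t)) := by
      simp only [hh, fc, smul_add]
      rw [intervalIntegral.integral_add]
      · simp_rw [smul_comm (ee _ _) (3 * Real.pi : ℝ)]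
        rw [intervalIntegral.integral_smul]
      all_goals exact Continuous.intervalIntegrable (by fun_prop) _ _
    rw [h1, ← hk k, ← add_smul]
    have : (3 * Real.pi + (2 * Real.pi * k - 3 * Real.pi)) = 2 * Real.pi * k := by ring
    rw [this, ← Complex.coe_smul]
    push_cast
    rfl)
  obtain ⟨hI, hxt⟩ := hreg
  set w : ℝ → Esp n := fun t => Complex.I • h (Int.fract t) with hw
  have hwc : Continuous w := by
    have : Continuous (fun t => h (Int.fract t)) := hhc.continuousOn.comp_fract'' (by simp only [hh, h01])
    exact (continuous_const_smul Complex.I).comp this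
  have hwp : Function.Periodic w 1 := fun t => by simp only [hw, Int.fract_add_one]
  have hw01 : ∀ t ∈ Icc (0:ℝ) 1, w t = Complex.I • h t := by
    intro t ht
    rcases eq_or_lt_of_le ht.2 with h1 | h1
    · rw [h1]; simp [hw, hh, h01]
    · simp only [hw]; rw [Int.fract_eq_self.mpr ⟨ht.1, h1⟩]
  set X : ℝ → Esp n := fun t => x 0 + ∫ s in (0:ℝ)..t, w s with hX
  have hX01 : ∀ t ∈ Icc (0:ℝ) 1, X t = x t := by
    intro t ht
    rw [hxt t ht]
    simp only [hX]
    congr 1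
    apply intervalIntegral.integral_congr
    intro s hs
    rw [uIcc_of_le ht.1] at hs
    exact hw01 s ⟨hs.1, hs.2.trans ht.2⟩
  have hXp : Function.Periodic X 1 := by
    intro t
    simp only [hX]
    congr 1
    rw [← intervalIntegral.integral_add_adjacent_intervals (b := t)
      (hwc.intervalIntegrable _ _) (hwc.intervalIntegrable _ _),
      hwp.intervalIntegral_add_eq t 0, zero_add]
    have : ∫ s in (0:ℝ)..1, w s = 0 := by
      rw [← hI]
      apply intervalIntegral.integral_congr
      intro s hs
      rw [uIcc_of_le zero_le_one] at hs
      exact hw01 s hs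
    rw [this, add_zero]
  have hXf : ∀ t, X t = x (Int.fract t) := by
    intro t
    rw [← hX01 _ ⟨Int.fract_nonneg t, (Int.fract_lt_one t).le⟩]
    have := hXp.sub_int_mul_eq (x := t) ⌊t⌋
    rw [mul_one] at this
    exact this.symm
  refine ⟨X, hXp, fun t => ?_, ?_⟩
  · have h1 : HasDerivAt X (w t) t :=
      (intervalIntegral.integral_hasDerivAt_right (hwc.intervalIntegrable _ _)
      hwc.aestronglyMeasurable.stronglyMeasurableAtFilter hwc.continuousAt).const_add _
    rw [hXf t]
    exact h1
  · refine lt_of_lt_of_eq hpos ?_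
    apply intervalIntegral.integral_congr
    intro s hs
    rw [uIcc_of_le zero_le_one] at hs
    simp only [hX01 s hs]

end HZ

namespace HZ

/-! ### Part 7: the extension argument -/

lemma exists_phi (R : ℝ) (hR : 0 < R) : ∃ φ : ℝ → ℝ, ContDiff ℝ (⊤ : ℕ∞) φ ∧ (∀ s, 0 ≤ φ s) ∧
    (∀ s ≤ R ^ 2, φ s = 0) ∧ (∀ s, 2 * R ^ 2 ≤ s → φ s = 3 * Real.pi / 2 * s) ∧
    ∃ B0, ∀ s, 0 ≤ s → deriv φ s * s - φ s ≤ B0 := by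
  set φ : ℝ → ℝ := fun s => 3 * Real.pi / 2 * s * Real.smoothTransition (s / R ^ 2 - 1) with hφ
  have hR2 : 0 < R ^ 2 := by positivity
  have hsm : ContDiff ℝ (⊤ : ℕ∞) φ := by
    have : ContDiff ℝ (⊤ : ℕ∞) fun s : ℝ => Real.smoothTransition (s / R ^ 2 - 1) :=
      Real.smoothTransition.contDiff.comp (by fun_prop)
    exact ContDiff.mul (by fun_prop) this
  have hlow : ∀ s ≤ R ^ 2, φ s = 0 := by
    intro s hs
    simp only [hφ]
    rw [Real.smoothTransition.zero_of_nonpos, mul_zero]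
    rw [sub_nonpos, div_le_one hR2]; exact hs
  have hhigh : ∀ s, 2 * R ^ 2 ≤ s → φ s = 3 * Real.pi / 2 * s := by
    intro s hs
    simp only [hφ]
    rw [Real.smoothTransition.one_of_one_le, mul_one]
    rw [le_sub_iff_add_le, le_div_iff₀ hR2]; linarith
  refine ⟨φ, hsm, fun s => ?_, hlow, hhigh, ?_⟩
  · rcases le_total s (R ^ 2) with h | h
    · rw [hlow s h]
    · have := Real.pi_pos
      have h1 := Real.smoothTransition.nonneg (s / R ^ 2 - 1)
      have : 0 ≤ s := hR2.le.trans h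
      simp only [hφ]; positivity
  · have hc : Continuous fun s => deriv φ s * s - φ s := by
      have h1 : Continuous (deriv φ) := hsm.continuous_deriv (by simp)
      have h2 := hsm.continuous
      fun_prop
    obtain ⟨B0, hB0⟩ := (isCompact_Icc (a := (0:ℝ)) (b := 2 * R ^ 2)).exists_bound_of_continuousOn
      hc.continuousOn
    refine ⟨max B0 0, fun s hs => ?_⟩
    rcases le_or_gt s (2 * R ^ 2) with h | h
    · exact (le_abs_self _).trans ((hB0 s ⟨hs, h⟩).trans (le_max_left _ _))
    · refine le_trans (le_of_eq ?_) (le_max_right _ _)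
      have h1 : φ =ᶠ[𝓝 s] fun s => 3 * Real.pi / 2 * s := by
        filter_upwards [lt_mem_nhds h] with u hu using hhigh u hu.le
      rw [h1.deriv_eq, hhigh s h.le, deriv_const_mul_field, deriv_id'']
      ring

lemma ham_of (k : Esp n → ℝ) (hk : ContDiff ℝ (⊤ : ℕ∞) k) (hs : HasCompactSupport k) (m δ : ℝ)
    (hpos : ∀ z, 0 ≤ 3 * Real.pi / 2 * ‖z‖ ^ 2 + m + k z) (hδ : 0 < δ)
    (hsmall : ∀ z, ‖z‖ ≤ δ → 3 * Real.pi / 2 * ‖z‖ ^ 2 + m + k z ≤ 1 / 2 * ‖z‖ ^ 2) :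
    ∃ D : Ham n, D.k = k ∧ D.m = m := by
  have hk1 : ContDiff ℝ 1 (fderiv ℝ k) := hk.fderiv_right (by norm_cast)
  have hs1 : HasCompactSupport (fderiv ℝ k) := hs.fderiv ℝ
  obtain ⟨B, hB⟩ := hs.exists_bound_of_continuous hk.continuous
  obtain ⟨M, hM⟩ := hs1.exists_bound_of_continuous hk1.continuous
  obtain ⟨L, hL⟩ := hk1.lipschitzWith_of_hasCompactSupport hs1 one_ne_zero
  refine ⟨{ k := k, g := gradient k, m := m, B := B, M := M, lam := L, δ := δ,
            hgrad := fun z => ?_, hk := hB, hg := fun z => ?_, hlam := L.2, hlip := fun z w => ?_,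
            hpos := hpos, hδ := hδ, hsmall := hsmall }, rfl, rfl⟩
  · exact (hk.differentiable (by simp) z).hasGradientAt
  · unfold gradient
    rw [LinearIsometryEquiv.norm_map]; exact hM z
  · unfold gradient
    rw [← map_sub, LinearIsometryEquiv.norm_map]
    have := hL.dist_le_mul z w
    rwa [dist_eq_norm, dist_eq_norm] at this

lemma sqrt_deriv (s : ℝ) : HasDerivAt (fun s => Real.sqrt (1 + s ^ 2) - 1)
    (s / Real.sqrt (1 + s ^ 2)) s := by
  have h1 : HasDerivAt (fun s : ℝ => 1 + s ^ 2) (2 * s) s := by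
    have := (hasDerivAt_pow 2 s).const_add 1
    simpa using this
  have h2 := (h1.sqrt (by positivity)).sub_const 1
  refine h2.congr_deriv ?_
  rw [mul_div_mul_left _ _ two_ne_zero]

theorem main_orbit (hn : 1 ≤ n) (r : ℝ) (hr : 0 < r) : ∃ C : ℝ, 0 < C ∧ ∀ H : Esp n → ℝ,
    ContDiff ℝ (⊤ : ℕ∞) H → IsCompact (tsupport H) → tsupport H ⊆ ball 0 r → C < H 0 →
    HasFastOrbit H := by
  set R := 2 * r with hRdef
  have hR : 0 < R := by positivity
  obtain ⟨φ, hφs, hφ0, hφl, hφh, B0, hB0⟩ := exists_phi R hR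
  refine ⟨|B0| + 1, by positivity, fun H hH hHc hHU hC => ?_⟩
  have hHd : ∀ z, HasGradientAt H (gradient H z) z := fun z =>
    (hH.differentiable (by simp) z).hasGradientAt
  have hφd : ∀ s, HasDerivAt φ (deriv φ s) s := fun s =>
    (hφs.differentiable (by simp) s).hasDerivAt
  -- the maximum point
  obtain ⟨p, hp⟩ : ∃ p, ∀ z, H z ≤ H p :=
    hH.continuous.exists_forall_ge_of_hasCompactSupport hHc
  set M := H p with hM
  have hM1 : |B0| + 1 < M := hC.trans_le (hp 0)
  have hMpos : 0 < M := by have := abs_nonneg B0; linarith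
  have hpr : ‖p‖ < r := by
    have : p ∈ tsupport H := subset_tsupport _ (by rw [Function.mem_support]; exact hMpos.ne')
    simpa using hHU this
  have hout : ∀ z, R ≤ ‖z‖ → H (p + z) = 0 ∧ gradient H (p + z) = 0 := by
    intro z hz
    have h1 : p + z ∉ tsupport H := by
      intro h
      have h2 : ‖p + z‖ < r := by simpa using hHU h
      have h3 : ‖z‖ ≤ ‖p + z‖ + ‖p‖ := by
        have := norm_sub_le (p + z) p
        rwa [add_sub_cancel_left] at this
      linarith
    refine ⟨image_eq_zero_of_notMem_tsupport h1, ?_⟩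
    unfold gradient
    rw [fderiv_of_notMem_tsupport ℝ h1, map_zero]
  set K0 : Esp n → ℝ := fun z => M - H (p + z) with hK0
  have hK0s : ContDiff ℝ (⊤ : ℕ∞) K0 :=
    contDiff_const.sub (hH.comp (contDiff_const.add contDiff_id))
  have hK0n : ∀ z, 0 ≤ K0 z := fun z => sub_nonneg.mpr (hp _)
  have hK0d : ∀ z, HasFDerivAt K0 (-(InnerProductSpace.toDual ℝ (Esp n) (gradient H (p + z)))) z := by
    intro z
    have h1 : HasFDerivAt (fun z => H (p + z))
      (InnerProductSpace.toDual ℝ (Esp n) (gradient H (p + z))) z := by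
      have := (hHd (p + z)).hasFDerivAt
      have h2 : HasFDerivAt (fun z : Esp n => p + z) (ContinuousLinearMap.id ℝ (Esp n)) z :=
        (hasFDerivAt_id z).const_add p
      exact this.comp z h2
    exact h1.const_sub M
  set f : ℝ → ℝ := fun s => Real.sqrt (1 + s ^ 2) - 1 with hf
  set θ : ℝ → ℝ := fun s => s / Real.sqrt (1 + s ^ 2) with hθ
  have hfd : ∀ s, HasDerivAt f (θ s) s := sqrt_deriv
  have hf0 : ∀ s, 0 ≤ f s := fun s => by
    simp only [hf, sub_nonneg, Real.one_le_sqrt]; nlinarith [sq_nonneg s]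
  have hf2 : ∀ s, f s ≤ 1 / 2 * s ^ 2 := fun s => by
    have : Real.sqrt (1 + s ^ 2) ≤ 1 + 1 / 2 * s ^ 2 := by
      apply Real.sqrt_le_iff.mpr
      constructor
      · positivity
      · nlinarith [sq_nonneg (s ^ 2)]
    simp only [hf]; linarith
  have hfM : M - 1 ≤ f M := by
    have : M ≤ Real.sqrt (1 + M ^ 2) := Real.le_sqrt_of_sq_le (by linarith)
    simp only [hf]; linarith
  have hfs : ContDiff ℝ (⊤ : ℕ∞) f := by
    refine ContDiff.sub (ContDiff.sqrt (by fun_prop) fun s => by positivity) contDiff_const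
  set m := f M with hm
  set k : Esp n → ℝ := fun z => f (K0 z) + φ (‖z‖ ^ 2) - 3 * Real.pi / 2 * ‖z‖ ^ 2 - m with hk
  have hns : ContDiff ℝ (⊤ : ℕ∞) fun z : Esp n => ‖z‖ ^ 2 := contDiff_norm_sq ℝ
  have hks : ContDiff ℝ (⊤ : ℕ∞) k :=
    (((hfs.comp hK0s).add (hφs.comp hns)).sub (contDiff_const.mul hns)).sub contDiff_const
  have hkc : HasCompactSupport k := by
    refine HasCompactSupport.intro (isCompact_closedBall (0 : Esp n) (2 * R)) fun z hz => ?_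
    have hz1 : 2 * R < ‖z‖ := by simpa using hz
    have hz2 : 2 * R ^ 2 ≤ ‖z‖ ^ 2 := by nlinarith
    simp only [hk, hK0]
    rw [(hout z (by linarith)).1, hφh _ hz2, sub_zero]
    simp [hm]
  have hkK : ∀ z, 3 * Real.pi / 2 * ‖z‖ ^ 2 + m + k z = f (K0 z) + φ (‖z‖ ^ 2) := fun z => by
    simp only [hk]; ring
  obtain ⟨δ, hδ, hδs⟩ : ∃ δ, 0 < δ ∧ ∀ z : Esp n, ‖z‖ ≤ δ →
      f (K0 z) + φ (‖z‖ ^ 2) ≤ 1 / 2 * ‖z‖ ^ 2 := by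
    have h1 : gradient H p = 0 := by
      unfold gradient
      have : IsLocalMax H p := Filter.Eventually.of_forall hp
      rw [this.fderiv_eq_zero, map_zero]
    have h2 := hK0d 0
    rw [add_zero, h1, map_zero, neg_zero] at h2
    have h3 := h2.isLittleO.def one_pos
    have h00 : K0 0 = 0 := by simp [hK0, hM]
    simp only [h00, sub_zero, zero_apply, one_mul] at h3
    obtain ⟨ε, hε, hε2⟩ := Metric.eventually_nhds_iff.mp h3
    refine ⟨min (ε / 2) R, by positivity, fun z hz => ?_⟩
    have h4 : ‖K0 z‖ ≤ ‖z‖ := hε2 (by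
      rw [dist_zero_right]; linarith [min_le_left (ε / 2) R])
    have h5 : ‖z‖ ≤ R := hz.trans (min_le_right _ _)
    rw [hφl _ (by gcongr), add_zero]
    refine (hf2 _).trans ?_
    rw [← sq_abs (K0 z), ← Real.norm_eq_abs]
    gcongr
  obtain ⟨D, hDk, hDm⟩ := ham_of k hks hkc m δ (fun z => by
    rw [hkK]; exact add_nonneg (hf0 _) (hφ0 _)) hδ (fun z hz => by rw [hkK]; exact hδs z hz)
  set V : Esp n → Esp n := fun z => (2 * deriv φ (‖z‖ ^ 2)) • z - θ (K0 z) • gradient H (p + z)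
    with hV
  have hDg : ∀ z, (3 * Real.pi) • z + D.g z = V z := by
    intro z
    have h1 : HasGradientAt k (V z - (3 * Real.pi) • z) z := by
      rw [hasGradientAt_iff_hasFDerivAt]
      have e1 := (hfd (K0 z)).comp_hasFDerivAt z (hK0d z)
      have e0 : HasFDerivAt (fun z : Esp n => ‖z‖ ^ 2) (2 • innerSL ℝ z) z :=
        (hasStrictFDerivAt_norm_sq z).hasFDerivAt
      have e2 := (hφd (‖z‖ ^ 2)).comp_hasFDerivAt z e0
      have e3 := ((e1.add e2).sub (e0.const_mul (3 * Real.pi / 2))).sub_const m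
      refine e3.congr_fderiv ?_
      ext w
      simp [hV]
      ring
    have h2 := D.hgrad z
    rw [hDk] at h2
    rw [h2.unique h1]
    abel
  obtain ⟨x, hxp, hxd, hxI⟩ := exists_orbit hn D
  simp_rw [hDg] at hxd
  have hxc : Continuous x := continuous_iff_continuousAt.mpr fun t => (hxd t).continuousAt
  have hintg : ∀ t, 1 / 2 * ⟪D.g (x t), x t⟫ - D.k (x t) - D.m =
      1 / 2 * ⟪V (x t), x t⟫ - f (K0 (x t)) - φ (‖x t‖ ^ 2) := by
    intro t
    rw [← hDg, hDk, hDm, inner_add_left, real_inner_smul_left, real_inner_self_eq_norm_sq]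
    linarith [hkK (x t)]
  simp_rw [hintg] at hxI
  have hneg : ¬ ∀ t, 1 / 2 * ⟪V (x t), x t⟫ - f (K0 (x t)) - φ (‖x t‖ ^ 2) ≤ 0 := by
    intro h
    have := intervalIntegral.integral_nonneg (μ := MeasureTheory.volume) (a := 0) (b := 1)
      (f := fun t => -(1 / 2 * ⟪V (x t), x t⟫ - f (K0 (x t)) - φ (‖x t‖ ^ 2))) zero_le_one
      (fun t _ => by linarith [h t])
    rw [intervalIntegral.integral_neg] at this
    linarith
  have hnc : ¬ ∀ t, x t = x 0 := by
    intro h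
    have h0 : ∀ t, V (x t) = 0 := by
      intro t
      have h1 : x = fun _ => x 0 := funext h
      have h2 : HasDerivAt x 0 t := by rw [h1]; exact hasDerivAt_const _ _
      have h3 := (hxd t).unique h2
      exact (smul_eq_zero.mp h3).resolve_left Complex.I_ne_zero
    refine hneg fun t => ?_
    rw [h0, inner_zero_left]
    linarith [hf0 (K0 (x t)), hφ0 (‖x t‖ ^ 2)]
  have hVout : ∀ z, R ≤ ‖z‖ → V z = (2 * deriv φ (‖z‖ ^ 2)) • z := by
    intro z hz
    simp only [hV]
    rw [(hout z hz).2, smul_zero, sub_zero]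
  obtain ⟨t0, ht0⟩ : ∃ t, ‖x t‖ < R := by
    by_contra hcon
    push Not at hcon
    refine hneg fun t => ?_
    rw [hVout _ (hcon t), real_inner_smul_left, real_inner_self_eq_norm_sq]
    have h1 : K0 (x t) = M := by simp only [hK0]; rw [(hout _ (hcon t)).1, sub_zero]
    rw [h1]
    have h2 := hB0 (‖x t‖ ^ 2) (by positivity)
    have h3 := le_abs_self B0
    linarith
  have hGc : ∀ t, φ (‖x t‖ ^ 2) = 0 := by
    have hd : ∀ t, HasDerivAt (fun t => φ (‖x t‖ ^ 2)) 0 t := by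
      intro t
      have h1 := (hφd (‖x t‖ ^ 2)).comp t (hxd t).norm_sq
      refine h1.congr_deriv ?_
      rcases le_or_gt R ‖x t‖ with h | h
      · rw [hVout _ h, smul_comm, real_inner_smul_right, inner_I_self]; simp
      · have h2 : φ =ᶠ[𝓝 (‖x t‖ ^ 2)] fun _ => 0 := by
          have : ‖x t‖ ^ 2 < R ^ 2 := by gcongr
          filter_upwards [gt_mem_nhds this] with u hu using hφl u (le_of_lt hu)
        rw [h2.deriv_eq]; simp
    intro t
    have h1 := is_const_of_deriv_eq_zero (fun t => (hd t).differentiableAt)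
      (fun t => (hd t).deriv) t t0
    rw [h1]
    exact hφl _ (by gcongr)
  have hφd0 : ∀ t, deriv φ (‖x t‖ ^ 2) = 0 := by
    intro t
    have : IsLocalMin φ (‖x t‖ ^ 2) := Filter.Eventually.of_forall fun s => by
      rw [hGc t]; exact hφ0 s
    exact this.deriv_eq_zero
  have hVx : ∀ t, V (x t) = -(θ (K0 (x t)) • gradient H (p + x t)) := by
    intro t
    simp only [hV]
    rw [hφd0, mul_zero, zero_smul, zero_sub]
  have hcons : ∀ t, K0 (x t) = K0 (x 0) := by
    have hd : ∀ t, HasDerivAt (fun t => K0 (x t)) 0 t := by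
      intro t
      have h1 := (hK0d (x t)).comp_hasDerivAt t (hxd t)
      refine h1.congr_deriv ?_
      rw [hVx]
      rw [neg_apply, InnerProductSpace.toDual_apply_apply, smul_neg,
        smul_comm Complex.I (θ (K0 (x t))), inner_neg_right, real_inner_smul_right, inner_I_self]
      simp
    intro t
    exact is_const_of_deriv_eq_zero (fun t => (hd t).differentiableAt)
      (fun t => (hd t).deriv) t 0
  set τ := θ (K0 (x 0)) with hτ
  have hxd2 : ∀ t, HasDerivAt x (-(τ • hamVF H (p + x t))) t := by
    intro t
    have h1 := hxd t
    rw [hVx, hcons, smul_neg, smul_comm] at h1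
    exact h1
  have hτ0 : 0 ≤ τ := div_nonneg (hK0n _) (Real.sqrt_nonneg _)
  have hτ1 : τ ≤ 1 := by
    apply div_le_one_of_le₀ _ (Real.sqrt_nonneg _)
    exact Real.le_sqrt_of_sq_le (by linarith)
  have hτne : τ ≠ 0 := by
    intro h
    refine hnc fun t => ?_
    rw [h] at hxd2
    simp only [zero_smul, neg_zero] at hxd2
    exact is_const_of_deriv_eq_zero (fun t => (hxd2 t).differentiableAt)
      (fun t => (hxd2 t).deriv) t 0
  have hτp : 0 < τ := lt_of_le_of_ne hτ0 hτne.symm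
  push Not at hnc
  obtain ⟨t1, ht1⟩ := hnc
  refine ⟨fun t => p + x (-t / τ), τ, ⟨hτp, fun t => ?_, fun t => ?_, -(τ * t1), 0, ?_⟩, hτ1⟩
  · have h1 : HasDerivAt (fun t : ℝ => -t / τ) (-1 / τ) t := (hasDerivAt_neg t).div_const τ
    have h2 := ((hxd2 (-t / τ)).scomp t h1).const_add p
    refine h2.congr_deriv ?_
    rw [smul_neg, smul_smul, ← neg_smul]
    have : -(-1 / τ * τ) = 1 := by field_simp
    rw [this, one_smul]
  · have h1 : -t / τ = -(t + τ) / τ + 1 := by field_simp; ring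
    simp only [h1, hxp]
  · have h1 : - -(τ * t1) / τ = t1 := by field_simp
    simp only [h1, neg_zero, zero_div]
    intro h
    exact ht1 (add_left_cancel h)

end HZ

/-- **Relative Hofer–Zehnder existence theorem for `W = ℝ^{2n}`, `M = {0}`**
(Theorem 2.1 of Ginzburg–Gürel): if `U` is a bounded open neighborhood of the
origin, there is a finite constant `C > 0`, depending only on `U`, such that
every smooth function `H` with compact support contained in `U` and `H 0 > C`
has a nonconstant periodic orbit of period at most one. -/
theorem stmt_0 (n : ℕ) (hn : 1 ≤ n) (U : Set (Esp n)) (hUopen : IsOpen U)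
    (hUbdd : Bornology.IsBounded U) (hU0 : (0 : Esp n) ∈ U) :
    ∃ C : ℝ, 0 < C ∧ ∀ H : Esp n → ℝ, ContDiff ℝ (⊤ : ℕ∞) H →
      IsCompact (tsupport H) → tsupport H ⊆ U → C < H 0 → HasFastOrbit H := by
  obtain ⟨r, hr, hUr⟩ := hUbdd.subset_ball_lt 0 0
  obtain ⟨C, hC, h⟩ := HZ.main_orbit hn r hr
  exact ⟨C, hC, fun H h1 h2 h3 h4 => h H h1 h2 (h3.trans hUr) h4⟩
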